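/- For every integer n ≥ 2 and every integer m ≥ 2, the number of multichains π_1 ≤ … ≤ π_{m-1} in NC^B(n-1,1) equals (2 + mn/((m-1)(n-1))) · C(m(n-1), n); that is, the zeta polynomial of NC^B(n-1,1) is Z(m) = (2 + mn/((m-1)(n-1))) · C(m(n-1), n). -/

import Mathlib

/-!  Common setup: annular non-crossing partitions of type B, following
Goulden–Nica–Oancea, "Enumerative properties of NC^(B)(p,q)". -/

/-- The underlying set `{±1, …, ±n}`, realized inside `ℤ`. -/
def signedSet (n : ℕ) : Set ℤ := {x : ℤ | x ≠ 0 ∧ |x| ≤ (n : ℤ)}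

/-- Membership in the hyperoctahedral group `B_n`, realized as the permutations of `ℤ`
that commute with negation and fix every point outside `{±1, …, ±n}`. -/
def inB (n : ℕ) (π : Equiv.Perm ℤ) : Prop :=
  (∀ x : ℤ, π (-x) = -(π x)) ∧ ∀ x : ℤ, x ∉ signedSet n → π x = x

/-- The set of generators of `B_n`:
`(i,j)(-i,-j)`, `(i,-j)(-i,j)` for `1 ≤ i ≠ j ≤ n`, and `(i,-i)` for `1 ≤ i ≤ n`. -/
def genB (n : ℕ) : Set (Equiv.Perm ℤ) :=
  {π | (∃ i j : ℤ, 1 ≤ i ∧ i ≤ (n : ℤ) ∧ 1 ≤ j ∧ j ≤ (n : ℤ) ∧ i ≠ j ∧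
          π = Equiv.swap i j * Equiv.swap (-i) (-j)) ∨
       (∃ i j : ℤ, 1 ≤ i ∧ i ≤ (n : ℤ) ∧ 1 ≤ j ∧ j ≤ (n : ℤ) ∧ i ≠ j ∧
          π = Equiv.swap i (-j) * Equiv.swap (-i) j) ∨
       (∃ i : ℤ, 1 ≤ i ∧ i ≤ (n : ℤ) ∧ π = Equiv.swap i (-i))}

/-- The length function `ℓ_B` on `B_n`: the least `k` such that `τ` is a product of `k`
generators from `genB n` (the empty product being the identity). -/
noncomputable def lenB (n : ℕ) (τ : Equiv.Perm ℤ) : ℕ :=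
  sInf {k : ℕ | ∃ l : List (Equiv.Perm ℤ),
    l.length = k ∧ (∀ g ∈ l, g ∈ genB n) ∧ l.prod = τ}

/-- The partial order on `B_n`:  `τ ≤ σ` iff `ℓ_B(σ) = ℓ_B(τ) + ℓ_B(τ⁻¹σ)`. -/
def leB (n : ℕ) (τ σ : Equiv.Perm ℤ) : Prop :=
  lenB n σ = lenB n τ + lenB n (τ⁻¹ * σ)

/-- The permutation `γ_{p,q} = (1,…,p,-1,…,-p)(p+1,…,p+q,-(p+1),…,-(p+q))`. -/
def gammaPQ (p q : ℕ) : Equiv.Perm ℤ :=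
  (((List.range p).map fun i => ((i : ℤ) + 1)) ++
      ((List.range p).map fun i => -((i : ℤ) + 1))).formPerm *
    (((List.range q).map fun i => ((p : ℤ) + (i : ℤ) + 1)) ++
      ((List.range q).map fun i => -((p : ℤ) + (i : ℤ) + 1))).formPerm

/-- The long cycle `γ_n = (1,…,n,-1,…,-n)` of `B_n` (disc case). -/
def gammaDisc (n : ℕ) : Equiv.Perm ℤ :=
  (((List.range n).map fun i => ((i : ℤ) + 1)) ++
    ((List.range n).map fun i => -((i : ℤ) + 1))).formPerm

/-- The annular non-crossing permutations of type B: `S^B_nc(p,q) = [ε, γ_{p,q}] ⊆ B_{p+q}`. -/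
def SncB (p q : ℕ) : Set (Equiv.Perm ℤ) :=
  {τ | inB (p + q) τ ∧ leB (p + q) τ (gammaPQ p q)}

/-- The orbit of `x` under the permutation `τ`. -/
def permOrbit (τ : Equiv.Perm ℤ) (x : ℤ) : Set ℤ := {y | ∃ m : ℤ, (τ ^ m) x = y}

/-- The partition `Ω(τ)` of `{±1,…,±n}` into orbits of `τ`. -/
def orbitsOn (n : ℕ) (τ : Equiv.Perm ℤ) : Set (Set ℤ) :=
  {A | ∃ x ∈ signedSet n, A = permOrbit τ x}

/-- The negation `-A` of a set `A ⊆ ℤ`. -/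
def negSet (A : Set ℤ) : Set ℤ := {x | -x ∈ A}

/-- The partition `Ω̃(τ)`, obtained from `Ω(τ)` by merging all inversion-invariant orbits
(orbits `A` with `A = -A`) into a single block. -/
def omegaTilde (n : ℕ) (τ : Equiv.Perm ℤ) : Set (Set ℤ) :=
  {A | A ∈ orbitsOn n τ ∧ negSet A ≠ A} ∪
    {B | B = ⋃₀ {A | A ∈ orbitsOn n τ ∧ negSet A = A} ∧ B.Nonempty}

/-- The annular non-crossing partitions of type B: `NC^B(p,q) = {Ω̃(τ) : τ ∈ S^B_nc(p,q)}`. -/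
def NCB (p q : ℕ) : Set (Set (Set ℤ)) :=
  {π | ∃ τ ∈ SncB p q, π = omegaTilde (p + q) τ}

/-- The type B non-crossing partitions of the disc: `NC^B(n) = {Ω̃(τ) : τ ∈ B_n, τ ≤ γ_n}`. -/
def NCBdisc (n : ℕ) : Set (Set (Set ℤ)) :=
  {π | ∃ τ, inB n τ ∧ leB n τ (gammaDisc n) ∧ π = omegaTilde n τ}

/-- Reverse refinement order on partitions: every block of `π` is contained in a block of `ρ`. -/
def refines (π ρ : Set (Set ℤ)) : Prop := ∀ A ∈ π, ∃ B ∈ ρ, A ⊆ B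

/-- The rank of a partition of `{±1,…,±n}`:
`n` minus half the number of blocks `A` with `A ≠ -A`. -/
noncomputable def rankNCB (n : ℕ) (π : Set (Set ℤ)) : ℕ :=
  n - {A | A ∈ π ∧ negSet A ≠ A}.ncard / 2

/-- The inner point set `{±(p+1), …, ±(p+q)}`. -/
def innerSet (p q : ℕ) : Set ℤ := {x : ℤ | (p : ℤ) < |x| ∧ |x| ≤ (p : ℤ) + (q : ℤ)}

/-- The connectivity of `π ∈ NC^B(p,q)`: half the number of blocks `A` with `A ≠ -A`
meeting both `{±1,…,±p}` and `{±(p+1),…,±(p+q)}`. -/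
noncomputable def connectivity (p q : ℕ) (π : Set (Set ℤ)) : ℕ :=
  {A | A ∈ π ∧ negSet A ≠ A ∧ (A ∩ signedSet p).Nonempty ∧
    (A ∩ innerSet p q).Nonempty}.ncard / 2

/-- The number of exterior pairs of blocks `{A, -A}` (with `A ≠ -A`, `A ⊆ {±1,…,±p}`). -/
noncomputable def extPairs (p : ℕ) (π : Set (Set ℤ)) : ℕ :=
  {A | A ∈ π ∧ negSet A ≠ A ∧ A ⊆ signedSet p}.ncard / 2

/-- The number of interior pairs of blocks `{A, -A}`
(with `A ≠ -A`, `A ⊆ {±(p+1),…,±(p+q)}`). -/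
noncomputable def intPairs (p q : ℕ) (π : Set (Set ℤ)) : ℕ :=
  {A | A ∈ π ∧ negSet A ≠ A ∧ A ⊆ innerSet p q}.ncard / 2

/-- The minimum `0̂` of `NC^B(p,q)` (with `n = p+q`): the partition into singletons. -/
def botNCB (n : ℕ) : Set (Set ℤ) := {A | ∃ x ∈ signedSet n, A = {x}}

/-- The maximum `1̂` of `NC^B(p,q)` (with `n = p+q`): the partition with a single block. -/
def topNCB (n : ℕ) : Set (Set ℤ) := {signedSet n}

/-- The orbit of `x` under the subgroup generated by `{τ, γ}`. -/
def jointOrbit (τ γ : Equiv.Perm ℤ) (x : ℤ) : Set ℤ :=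
  {y | ∃ g ∈ Subgroup.closure ({τ, γ} : Set (Equiv.Perm ℤ)), g x = y}

/-- The orbits on `{±1,…,±n}` of the subgroup generated by `{τ, γ}`. -/
def jointOrbitsOn (n : ℕ) (τ γ : Equiv.Perm ℤ) : Set (Set ℤ) :=
  {Y | ∃ x ∈ signedSet n, Y = jointOrbit τ γ x}


open PowerSeries in
theorem exists_G (m : ℕ) : ∃ G : PowerSeries ℝ, G = X * (1 + G) ^ m := by
  let g : ℕ → PowerSeries ℝ := fun k => Nat.rec 0 (fun _ a => X * (1 + a) ^ m) k
  have g_succ : ∀ k, g (k+1) = X * (1 + g k) ^ m := fun k => rfl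
  have step : ∀ a b : PowerSeries ℝ, ∀ k, X ^ k ∣ a - b →
      X ^ (k+1) ∣ X * (1 + a) ^ m - X * (1 + b) ^ m := by
    intro a b k h
    rw [← mul_sub, pow_succ']
    refine mul_dvd_mul_left _ (h.trans ?_)
    have := sub_dvd_pow_sub_pow (1 + a) (1 + b) m
    simpa using this
  have h1 : ∀ k, X ^ (k+1) ∣ g (k+1) - g k := by
    intro k
    induction k with
    | zero => rw [g_succ]; simp [g]
    | succ k ih => rw [g_succ (k+1), g_succ k]; exact step _ _ _ ih
  have h2 : ∀ r d, coeff r (g (r + d)) = coeff r (g r) := by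
    intro r d
    induction d with
    | zero => rfl
    | succ d ih =>
      rw [← ih, ← sub_eq_zero, ← map_sub]
      exact (X_pow_dvd_iff.1 (h1 (r+d))) r (by omega)
  let G : PowerSeries ℝ := PowerSeries.mk fun r => coeff r (g r)
  have h3 : ∀ k, X ^ (k+1) ∣ G - g k := by
    intro k
    rw [X_pow_dvd_iff]
    intro r hr
    obtain ⟨d, rfl⟩ := Nat.exists_eq_add_of_le (Nat.lt_succ_iff.1 hr)
    simp [G, h2]
  refine ⟨G, ?_⟩
  ext r
  rw [← sub_eq_zero, ← map_sub]
  have e : G - X * (1 + G) ^ m = (G - g (r+1)) - (X * (1 + G)^m - X * (1 + g r) ^ m) := by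
    rw [g_succ]; ring
  rw [e]
  have key : X ^ (r+1) ∣ (G - g (r+1)) - (X * (1 + G)^m - X * (1 + g r) ^ m) := by
    refine dvd_sub ?_ ?_
    · exact (pow_dvd_pow _ (by omega)).trans (h3 (r+1))
    · exact (pow_dvd_pow _ (by omega)).trans (step _ _ _ (h3 r))
  exact X_pow_dvd_iff.1 key r (by omega)

noncomputable def GG (m : ℕ) : PowerSeries ℝ := (exists_G m).choose

open PowerSeries in
theorem GG_eq (m : ℕ) : GG m = X * (1 + GG m) ^ m := (exists_G m).choose_spec

open PowerSeries in
noncomputable def BB (m : ℕ) : PowerSeries ℝ := (1 - X * ((m : PowerSeries ℝ) * (1 + GG m) ^ (m-1)))⁻¹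

open PowerSeries in
theorem BB_eq (m : ℕ) : BB m = 1 + X * ((m : PowerSeries ℝ) * (1 + GG m) ^ (m-1) * BB m) := by
  have : (1 - X * ((m : PowerSeries ℝ) * (1 + GG m) ^ (m-1))) * BB m = 1 :=
    PowerSeries.mul_inv_cancel _ (by simp)
  linear_combination this

def cc (m r k : ℕ) : ℕ := if k ≤ r then Nat.choose (m * r) (r - k) else 0

theorem vand (M K a r : ℕ) : ∑ j ∈ Finset.range (M+1), M.choose j *
    (if a + j ≤ r then K.choose (r - (a + j)) else 0) = if a ≤ r then (M+K).choose (r - a) else 0 := by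
  split_ifs with h
  · obtain ⟨s, rfl⟩ := Nat.exists_eq_add_of_le h
    rw [Nat.add_sub_cancel_left, Nat.add_choose_eq, Finset.Nat.sum_antidiagonal_eq_sum_range_succ (fun i j => M.choose i * K.choose j)]
    have e : ∀ j, (if a + j ≤ a + s then K.choose (a + s - (a + j)) else 0) = if j ≤ s then K.choose (s - j) else 0 := by
      intro j
      have : (a + j ≤ a + s) ↔ j ≤ s := by omega
      simp only [this]
      congr 2; omega
    simp only [e]
    have l : ∀ T, M ≤ T → s ≤ T → ∑ j ∈ Finset.range (M+1), M.choose j * (if j ≤ s then K.choose (s - j) else 0)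
       = ∑ j ∈ Finset.range (T+1), M.choose j * (if j ≤ s then K.choose (s - j) else 0) := by
      intro T h1 h2
      apply Finset.sum_subset
      · intro x; simp; omega
      · intro x _ hx
        rw [Nat.choose_eq_zero_of_lt (by simpa [Nat.lt_succ_iff] using hx)]; simp
    rw [l (M + s) (by omega) (by omega)]
    symm
    rw [Finset.sum_congr rfl (g := fun j => M.choose j * (if j ≤ s then K.choose (s - j) else 0))]
    · apply Finset.sum_subset
      · intro x; simp; omega
      · intro x _ hx
        rw [if_neg (by simpa [Nat.lt_succ_iff] using hx)]; simp
    · intro x hx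
      rw [if_pos (by simpa [Nat.lt_succ_iff] using hx)]
  · apply Finset.sum_eq_zero
    intro j _
    rw [if_neg (by omega), mul_zero]

theorem vand_cc (m M a r : ℕ) : ∑ j ∈ Finset.range (M+1), (M.choose j : ℝ) * (cc m r (a + j) : ℝ) =
    ((if a ≤ r then (M+m*r).choose (r - a) else 0 : ℕ) : ℝ) := by
  rw [← vand M (m*r) a r]
  push_cast [cc]
  rfl

theorem choose_mul_aux (m r : ℕ) (hm : 1 ≤ m) :
    m * (m - 1 + m * r).choose r = (m * (r+1)).choose (r+1) := by
  obtain ⟨q, rfl⟩ : ∃ q, m = q + 1 := ⟨m - 1, by omega⟩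
  have h := Nat.add_one_mul_choose_eq (q + (q+1) * r) r
  have e : q + (q+1) * r + 1 = (q+1) * (r+1) := by ring
  rw [e] at h
  simp only [Nat.add_sub_cancel]
  have : (r+1) * ((q+1) * (q + (q+1) * r).choose r) = (r+1) * ((q+1) * (r+1)).choose (r+1) := by
    linarith
  exact Nat.eq_of_mul_eq_mul_left (by omega) this

open PowerSeries in
theorem coeff_GB (m : ℕ) (hm : 1 ≤ m) (r : ℕ) : ∀ k, coeff r (GG m ^ k * BB m) = (cc m r k : ℝ) := by
  have hG0 : constantCoeff (GG m) = 0 := by rw [GG_eq]; simp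
  induction r with
  | zero =>
    intro k
    rcases k with _ | k
    · rw [BB_eq]; simp [cc]
    · simp [cc, hG0]
  | succ r ih =>
    intro k
    rcases k with _ | k
    · rw [BB_eq, pow_zero, one_mul, map_add, coeff_succ_X_mul, add_comm (1 : PowerSeries ℝ) (GG m), add_pow]
      simp only [one_pow, mul_one]
      have : (m : PowerSeries ℝ) * (∑ j ∈ Finset.range (m - 1 + 1), GG m ^ j * ((m-1).choose j : PowerSeries ℝ)) * BB m
        = (C (m : ℝ)) * ∑ j ∈ Finset.range (m - 1 + 1), C ((m-1).choose j : ℝ) * (GG m ^ j * BB m) := by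
        rw [mul_assoc, Finset.sum_mul]
        simp only [map_natCast]
        congr 1
        apply Finset.sum_congr rfl
        intros; ring
      rw [this, coeff_C_mul, map_sum]
      simp only [coeff_C_mul, ih]
      have v := vand_cc m (m-1) 0 r
      simp only [zero_add, Nat.zero_le, if_true, Nat.sub_zero] at v
      rw [v]
      simp only [cc, Nat.zero_le, if_true, Nat.sub_zero]
      rw [← choose_mul_aux m r hm]
      simp [coeff_one]
    · have e : GG m ^ (k+1) * BB m = X * ∑ j ∈ Finset.range (m + 1), C (m.choose j : ℝ) * (GG m ^ (k + j) * BB m) := by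
        rw [pow_succ]
        nth_rewrite 2 [GG_eq]
        rw [add_comm (1 : PowerSeries ℝ) (GG m), add_pow, Finset.mul_sum, Finset.mul_sum, Finset.mul_sum, Finset.sum_mul]
        apply Finset.sum_congr rfl
        intros; simp only [map_natCast]; ring
      rw [e, coeff_succ_X_mul, map_sum]
      simp only [coeff_C_mul, ih]
      rw [vand_cc]
      simp only [cc]
      have : (k + 1 ≤ r + 1) ↔ k ≤ r := by omega
      simp only [this]
      congr 3
      · ring
      · omega

open PowerSeries in
theorem GG_deriv (m : ℕ) (hm : 1 ≤ m) : X * derivative ℝ (GG m) = GG m * BB m := by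
  have h1 : X * derivative ℝ (GG m) = GG m + X * ((m : PowerSeries ℝ) * (1 + GG m) ^ (m-1)) * (X * derivative ℝ (GG m)) := by
    have := congrArg (derivative ℝ) (GG_eq m)
    rw [Derivation.leibniz, Derivation.leibniz_pow, map_add] at this
    simp only [smul_eq_mul, nsmul_eq_mul, derivative_X, map_one_eq_zero, Derivation.map_one_eq_zero, zero_add, mul_one] at this
    have h := GG_eq m
    linear_combination X * this - h
  have h2 := BB_eq m
  have h3 : (1 - X * ((m : PowerSeries ℝ) * (1 + GG m) ^ (m-1))) * BB m = 1 :=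
    PowerSeries.mul_inv_cancel _ (by simp)
  linear_combination (BB m) * h1 - (X * derivative ℝ (GG m)) * h3

open PowerSeries in
theorem coeff_Gk (m : ℕ) (hm : 1 ≤ m) (r k : ℕ) : (r : ℝ) * coeff r (GG m ^ k) = k * (cc m r k : ℝ) := by
  rcases k with _ | k
  · rcases r with _ | r <;> simp [coeff_one]
  · have h : X * derivative ℝ (GG m ^ (k+1)) = C ((k+1 : ℕ) : ℝ) * (GG m ^ (k+1) * BB m) := by
      rw [Derivation.leibniz_pow]
      simp only [nsmul_eq_mul, smul_eq_mul, map_natCast, Nat.add_sub_cancel]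
      have := GG_deriv m hm
      linear_combination ((k+1 : ℕ) : PowerSeries ℝ) * GG m ^ k * this
    have h2 := congrArg (coeff r) h
    rw [coeff_C_mul, coeff_GB m hm] at h2
    rw [← h2]
    rcases r with _ | r
    · simp
    · rw [coeff_succ_X_mul, coeff_derivative]; push_cast; ring

noncomputable def Av (m r : ℕ) : ℝ := PowerSeries.coeff r (GG m)
noncomputable def Bv (m r : ℕ) : ℝ := PowerSeries.coeff r (BB m)

theorem Bv_eq (m : ℕ) (hm : 1 ≤ m) (r : ℕ) : Bv m r = ((m * r).choose r : ℕ) := by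
  have := coeff_GB m hm r 0
  simpa [cc, Bv] using this

theorem Bv_nonneg (m : ℕ) (hm : 1 ≤ m) (r : ℕ) : 0 ≤ Bv m r := by
  rw [Bv_eq m hm]; positivity

theorem Av_zero (m : ℕ) : Av m 0 = 0 := by
  unfold Av; rw [GG_eq]; simp

theorem Av_nonneg (m : ℕ) (hm : 1 ≤ m) (r : ℕ) : 0 ≤ Av m r := by
  have := coeff_Gk m hm r 1
  rcases r with _ | r
  · rw [Av_zero]
  · simp only [pow_one, Nat.cast_one, one_mul] at this
    have h2 : (0:ℝ) ≤ ((r+1 : ℕ) : ℝ) * Av m (r+1) := by unfold Av; rw [this]; positivity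
    exact nonneg_of_mul_nonneg_right h2 (by positivity)

open PowerSeries in
theorem Av_one (m : ℕ) : Av m 1 = 1 := by
  unfold Av; rw [GG_eq, coeff_succ_X_mul]
  have hG0 : constantCoeff (GG m) = 0 := by rw [GG_eq]; simp
  simp [hG0]

open PowerSeries in
/-- paired recursion -/
theorem Av_rec (m r : ℕ) : Av m (r+1) = ∑ k ∈ Finset.range (m+1), (m.choose k : ℝ) * coeff r (GG m ^ k) := by
  unfold Av
  nth_rewrite 1 [GG_eq]
  rw [coeff_succ_X_mul, add_comm, add_pow, map_sum]
  apply Finset.sum_congr rfl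
  intro k _
  rw [one_pow, mul_one, mul_comm, ← coeff_C_mul]; simp

open PowerSeries in
/-- balanced recursion -/
theorem Bv_rec (m r : ℕ) (hm : 1 ≤ m) : Bv m (r+1) = ∑ k ∈ Finset.range (m+1), (m.choose k : ℝ) *
    ((k : ℝ) * coeff r (GG m ^ (k-1) * BB m)) := by
  unfold Bv
  nth_rewrite 1 [BB_eq]
  rw [map_add, coeff_succ_X_mul, add_comm (1 : PowerSeries ℝ) (GG m), add_pow, Finset.sum_range_succ' _ m]
  obtain ⟨q, rfl⟩ : ∃ q, m = q + 1 := ⟨m - 1, by omega⟩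
  simp only [coeff_one, Nat.add_sub_cancel, one_pow, mul_one, Nat.cast_zero, zero_mul, mul_zero, add_zero]
  rw [if_neg (by omega), zero_add, Finset.mul_sum, Finset.sum_mul, map_sum]
  apply Finset.sum_congr rfl
  intro k _
  have h := Nat.add_one_mul_choose_eq q k
  have h' : ((q:ℝ)+1) * (q.choose k : ℝ) = ((q+1).choose (k+1) : ℝ) * (k+1) := by exact_mod_cast h
  have : ((q+1 : ℕ) : PowerSeries ℝ) * (GG (q+1) ^ k * (q.choose k : PowerSeries ℝ)) * BB (q+1) =
     C (((q:ℝ)+1) * (q.choose k : ℝ)) * (GG (q+1) ^ k * BB (q+1)) := by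
     simp only [map_mul, map_add, map_natCast, map_one]; push_cast; ring
  rw [this, coeff_C_mul, h']; push_cast; ring

open PowerSeries in
theorem top_formula (m p : ℕ) (hm : 1 ≤ m) :
    (m : ℝ) * Bv m p + 2 * p * ∑ k ∈ Finset.range m, (m.choose (k+1) : ℝ) * coeff p (GG m ^ k)
     = m * (m * p).choose p + 2 * (m * p).choose (p+1) := by
  rw [Bv_eq m hm, mul_assoc, Finset.mul_sum]
  have e : ∀ k, (p : ℝ) * ((m.choose (k+1) : ℝ) * coeff p (GG m ^ k)) =
      m * (((m-1).choose k : ℝ) * cc m p k) - (m.choose (k+1) : ℝ) * cc m p k := by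
    intro k
    have := coeff_Gk m hm p k
    obtain ⟨q, rfl⟩ : ∃ q, m = q + 1 := ⟨m - 1, by omega⟩
    have h := Nat.add_one_mul_choose_eq q k
    have h' : ((q:ℝ)+1) * (q.choose k : ℝ) = ((q+1).choose (k+1) : ℝ) * (k+1) := by exact_mod_cast h
    simp only [Nat.add_sub_cancel]; push_cast
    linear_combination ((q+1).choose (k+1) : ℝ) * this - (cc (q+1) p k : ℝ) * h'
  simp only [e]
  rw [Finset.sum_sub_distrib, ← Finset.mul_sum]
  have v1 := vand_cc m (m-1) 0 p
  rw [Nat.sub_add_cancel hm] at v1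
  simp only [zero_add, Nat.zero_le, if_true, Nat.sub_zero] at v1
  rw [v1]
  have v2 := vand m (m*p) 0 (p+1)
  rw [Finset.sum_range_succ'] at v2
  simp only [zero_add, Nat.zero_le, if_true, Nat.sub_zero, Nat.choose_zero_right, one_mul] at v2
  have e2 : ∀ k, (if k + 1 ≤ p + 1 then (m*p).choose (p + 1 - (k+1)) else 0) = cc m p k := by
    intro k; simp only [cc]; simp
  simp only [e2] at v2
  have v3 := choose_mul_aux m p hm
  have v2' : ∑ k ∈ Finset.range m, (m.choose (k+1) : ℝ) * (cc m p k : ℝ) + ((m*p).choose (p+1) : ℝ) = ((m + m * p).choose (p+1) : ℝ) := by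
    exact_mod_cast v2
  have v3' : (m : ℝ) * ((m - 1 + m * p).choose p : ℝ) = ((m + m*p).choose (p+1) : ℝ) := by
    rw [show m + m * p = m * (p+1) by ring, ← v3]; push_cast; ring
  rw [v3']
  linarith


theorem ss_neg {N : ℕ} {x : ℤ} : -x ∈ signedSet N ↔ x ∈ signedSet N := by
  simp [signedSet]

theorem ss_iff {N : ℕ} {x : ℤ} : x ∈ signedSet N ↔ x ≠ 0 ∧ -(N:ℤ) ≤ x ∧ x ≤ N := by
  simp [signedSet, abs_le]

theorem inB_one (N : ℕ) : inB N 1 := ⟨fun _ => rfl, fun _ _ => rfl⟩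

theorem inB_mul {N : ℕ} {a b : Equiv.Perm ℤ} (ha : inB N a) (hb : inB N b) : inB N (a * b) := by
  refine ⟨fun x => ?_, fun x hx => ?_⟩
  · simp [hb.1, ha.1]
  · simp [hb.2 x hx, ha.2 x hx]

theorem inB_inv {N : ℕ} {a : Equiv.Perm ℤ} (ha : inB N a) : inB N a⁻¹ := by
  refine ⟨fun x => ?_, fun x hx => ?_⟩
  · rw [Equiv.Perm.inv_eq_iff_eq, ha.1]; simp
  · rw [Equiv.Perm.inv_eq_iff_eq, ha.2 x hx]

theorem inB_mono {N M : ℕ} (h : N ≤ M) {a : Equiv.Perm ℤ} (ha : inB N a) : inB M a := by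
  refine ⟨ha.1, fun x hx => ha.2 x fun h' => hx ?_⟩
  rw [ss_iff] at *
  omega

theorem inB_mem {N : ℕ} {a : Equiv.Perm ℤ} (ha : inB N a) {x : ℤ} : a x ∈ signedSet N ↔ x ∈ signedSet N := by
  constructor
  · intro h
    by_contra hx
    rw [ha.2 x hx] at h; exact hx h
  · intro h
    by_contra hx
    have := ha.2 _ hx
    rw [a.injective this] at hx; exact hx h

/-! reflections -/
def rf (x y : ℤ) : Equiv.Perm ℤ :=
  if y = -x then Equiv.swap x (-x) else Equiv.swap x y * Equiv.swap (-x) (-y)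

theorem rf_apply {x y : ℤ} (hx : x ≠ 0) (hy : y ≠ 0) (z : ℤ) : rf x y z =
    if z = x then y else if z = y then x else if z = -x then -y else if z = -y then -x else z := by
  unfold rf
  split_ifs <;> simp only [Equiv.Perm.mul_apply, Equiv.swap_apply_def] <;> split_ifs <;> omega

theorem rf_left {x y : ℤ} (hx : x ≠ 0) (hy : y ≠ 0) : rf x y x = y := by
  rw [rf_apply hx hy]; simp

theorem rf_right {x y : ℤ} (hx : x ≠ 0) (hy : y ≠ 0) : rf x y y = x := by
  rw [rf_apply hx hy]; split_ifs <;> omega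

theorem rf_mul_self {x y : ℤ} (hx : x ≠ 0) (hy : y ≠ 0) : rf x y * rf x y = 1 := by
  ext z
  simp only [Equiv.Perm.mul_apply, rf_apply hx hy, Equiv.Perm.one_apply]
  split_ifs <;> omega

theorem rf_inv {x y : ℤ} (hx : x ≠ 0) (hy : y ≠ 0) : (rf x y)⁻¹ = rf x y :=
  inv_eq_of_mul_eq_one_left (rf_mul_self hx hy)

theorem rf_inB {N : ℕ} {x y : ℤ} (hx : x ∈ signedSet N) (hy : y ∈ signedSet N) : inB N (rf x y) := by
  have hx' := hx
  have hy' := hy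
  rw [ss_iff] at hx hy
  refine ⟨fun z => ?_, fun z hz => ?_⟩
  · simp only [rf_apply hx.1 hy.1]; split_ifs <;> omega
  · rw [ss_iff] at hz
    simp only [rf_apply hx.1 hy.1]; split_ifs <;> omega

theorem rf_mem_gen {N : ℕ} {x y : ℤ} (hx : x ∈ signedSet N) (hy : y ∈ signedSet N) (h : x ≠ y) :
    rf x y ∈ genB N := by
  rw [ss_iff] at hx hy
  by_cases h2 : y = -x
  · subst h2
    right; right
    rcases lt_or_gt_of_ne hx.1 with h3 | h3
    · exact ⟨-x, by omega, by omega, by ext z; simp [rf, Equiv.swap_comm]⟩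
    · exact ⟨x, by omega, by omega, by simp [rf]⟩
  · rcases lt_or_gt_of_ne hx.1 with h3 | h3 <;> rcases lt_or_gt_of_ne hy.1 with h4 | h4
    · left
      refine ⟨-x, -y, by omega, by omega, by omega, by omega, by omega, ?_⟩
      ext z
      simp only [rf_apply hx.1 hy.1, Equiv.Perm.mul_apply, Equiv.swap_apply_def]; split_ifs <;> omega
    · right; left
      refine ⟨-x, y, by omega, by omega, by omega, by omega, by omega, ?_⟩
      ext z
      simp only [rf_apply hx.1 hy.1, Equiv.Perm.mul_apply, Equiv.swap_apply_def]; split_ifs <;> omega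
    · right; left
      refine ⟨x, -y, by omega, by omega, by omega, by omega, by omega, ?_⟩
      ext z
      simp only [rf_apply hx.1 hy.1, Equiv.Perm.mul_apply, Equiv.swap_apply_def]; split_ifs <;> omega
    · left
      refine ⟨x, y, by omega, by omega, by omega, by omega, by omega, ?_⟩
      ext z
      simp only [rf_apply hx.1 hy.1, Equiv.Perm.mul_apply, Equiv.swap_apply_def]; split_ifs <;> omega

theorem gen_is_rf {N : ℕ} {g : Equiv.Perm ℤ} (hg : g ∈ genB N) :
    ∃ x y, x ∈ signedSet N ∧ y ∈ signedSet N ∧ x ≠ y ∧ g = rf x y := by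
  simp only [ss_iff]
  rcases hg with ⟨i, j, h1, h2, h3, h4, h5, rfl⟩ | ⟨i, j, h1, h2, h3, h4, h5, rfl⟩ | ⟨i, h1, h2, rfl⟩
  · refine ⟨i, j, by omega, by omega, by omega, ?_⟩
    rw [rf, if_neg (by omega)]
  · refine ⟨i, -j, by omega, by omega, by omega, ?_⟩
    rw [rf, if_neg (by omega), neg_neg]
  · refine ⟨i, -i, by omega, by omega, by omega, ?_⟩
    rw [rf, if_pos rfl]

/-! linear algebra -/
def VV (N : ℕ) : Submodule ℚ (ℤ → ℚ) where
  carrier := {v | (∀ x, v (-x) = -v x) ∧ ∀ x, x ∉ signedSet N → v x = 0}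
  add_mem' := by
    rintro a b ⟨h1, h2⟩ ⟨h3, h4⟩
    refine ⟨fun x => ?_, fun x hx => ?_⟩
    · simp [h1, h3]; ring
    · simp [h2 x hx, h4 x hx]
  zero_mem' := by simp
  smul_mem' := by
    rintro c a ⟨h1, h2⟩
    refine ⟨fun x => ?_, fun x hx => ?_⟩
    · simp [h1]
    · simp [h2 x hx]

def Fx (N : ℕ) (τ : Equiv.Perm ℤ) : Submodule ℚ (ℤ → ℚ) where
  carrier := {v | v ∈ VV N ∧ ∀ x, v (τ x) = v x}
  add_mem' := by
    rintro a b ⟨h1, h2⟩ ⟨h3, h4⟩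
    exact ⟨(VV N).add_mem h1 h3, fun x => by simp [h2, h4]⟩
  zero_mem' := ⟨(VV N).zero_mem, by simp⟩
  smul_mem' := by
    rintro c a ⟨h1, h2⟩
    exact ⟨(VV N).smul_mem _ h1, fun x => by simp [h2]⟩

theorem mem_VV {N : ℕ} {v : ℤ → ℚ} : v ∈ VV N ↔ (∀ x, v (-x) = -v x) ∧ ∀ x, x ∉ signedSet N → v x = 0 := Iff.rfl
theorem mem_Fx {N : ℕ} {τ : Equiv.Perm ℤ} {v : ℤ → ℚ} : v ∈ Fx N τ ↔ v ∈ VV N ∧ ∀ x, v (τ x) = v x := Iff.rfl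

theorem Fx_le (N : ℕ) (τ : Equiv.Perm ℤ) : Fx N τ ≤ VV N := fun _ h => h.1

instance VV_fin (N : ℕ) : FiniteDimensional ℚ (VV N) := by
  let f : VV N →ₗ[ℚ] (Finset.Icc (-(N:ℤ)) N → ℚ) :=
    { toFun := fun v x => v.1 x.1
      map_add' := fun _ _ => rfl
      map_smul' := fun _ _ => rfl }
  refine FiniteDimensional.of_injective f ?_
  intro a b h
  ext x
  by_cases hx : x ∈ signedSet N
  · rw [ss_iff] at hx
    exact congrFun h ⟨x, Finset.mem_Icc.2 hx.2⟩
  · rw [a.2.2 x hx, b.2.2 x hx]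

instance Fx_fin (N : ℕ) (τ : Equiv.Perm ℤ) : FiniteDimensional ℚ (Fx N τ) :=
  Submodule.finiteDimensional_of_le (Fx_le N τ)

noncomputable def dV (N : ℕ) : ℕ := Module.finrank ℚ (VV N)
noncomputable def dF (N : ℕ) (τ : Equiv.Perm ℤ) : ℕ := Module.finrank ℚ (Fx N τ)
noncomputable def cod (N : ℕ) (τ : Equiv.Perm ℤ) : ℕ := dV N - dF N τ

theorem dF_le (N : ℕ) (τ : Equiv.Perm ℤ) : dF N τ ≤ dV N := Submodule.finrank_mono (Fx_le N τ)

theorem cod_add (N : ℕ) (τ : Equiv.Perm ℤ) : cod N τ + dF N τ = dV N := Nat.sub_add_cancel (dF_le N τ)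

theorem dim_inf {N : ℕ} {A B : Submodule ℚ (ℤ → ℚ)} (hA : A ≤ VV N) (hB : B ≤ VV N) :
    Module.finrank ℚ A + Module.finrank ℚ B ≤ dV N + Module.finrank ℚ (A ⊓ B : Submodule ℚ (ℤ → ℚ)) := by
  have := Submodule.finiteDimensional_of_le hA
  have := Submodule.finiteDimensional_of_le hB
  rw [← Submodule.finrank_sup_add_finrank_inf_eq]
  have : Module.finrank ℚ (A ⊔ B : Submodule ℚ (ℤ → ℚ)) ≤ dV N := Submodule.finrank_mono (sup_le hA hB)
  omega

theorem Fx_inf_le (N : ℕ) (a b : Equiv.Perm ℤ) : Fx N a ⊓ Fx N b ≤ Fx N (a * b) := by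
  rintro v ⟨h1, h2⟩
  exact ⟨h1.1, fun x => by rw [Equiv.Perm.mul_apply, h1.2, h2.2]⟩

theorem cod_mul (N : ℕ) (a b : Equiv.Perm ℤ) : cod N (a * b) ≤ cod N a + cod N b := by
  have h1 := dim_inf (Fx_le N a) (Fx_le N b)
  have h2 : Module.finrank ℚ (Fx N a ⊓ Fx N b : Submodule ℚ (ℤ → ℚ)) ≤ dF N (a * b) :=
    Submodule.finrank_mono (Fx_inf_le N a b)
  have := cod_add N a
  have := cod_add N b
  have := cod_add N (a*b)
  unfold dF at *
  omega

theorem cod_one (N : ℕ) : cod N 1 = 0 := by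
  have : Fx N 1 = VV N := le_antisymm (Fx_le _ _) fun v hv => ⟨hv, fun x => rfl⟩
  unfold cod dF dV; rw [this]; simp

theorem mem_Fx_rf {N : ℕ} {x y : ℤ} (hx : x ≠ 0) (hy : y ≠ 0) {v : ℤ → ℚ} (hv : v ∈ VV N) :
    v ∈ Fx N (rf x y) ↔ v x = v y := by
  constructor
  · intro h
    have := h.2 x
    rw [rf_left hx hy] at this
    exact this.symm
  · intro h
    refine ⟨hv, fun z => ?_⟩
    rw [rf_apply hx hy]
    split_ifs with h1 h2 h3 h4
    · rw [h1, h]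
    · rw [h2, h]
    · rw [h3, hv.1, hv.1, h]
    · rw [h4, hv.1, hv.1, h]
    · rfl

theorem cod_rf {N : ℕ} {x y : ℤ} (hx : x ≠ 0) (hy : y ≠ 0) : cod N (rf x y) ≤ 1 := by
  let f : VV N →ₗ[ℚ] ℚ := 
    { toFun := fun v => v.1 x - v.1 y
      map_add' := fun a b => by simp; ring
      map_smul' := fun c a => by simp; ring }
  have h1 := LinearMap.finrank_range_add_finrank_ker f
  have h2 : Module.finrank ℚ (LinearMap.range f) ≤ 1 := by
    simpa using Submodule.finrank_le (LinearMap.range f)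
  have h3 : (LinearMap.ker f).map (VV N).subtype = Fx N (rf x y) := by
    ext v
    constructor
    · rintro ⟨w, hw, rfl⟩
      exact (mem_Fx_rf hx hy w.2).2 (sub_eq_zero.1 hw)
    · intro h
      exact ⟨⟨v, h.1⟩, sub_eq_zero.2 ((mem_Fx_rf hx hy h.1).1 h), rfl⟩
  have h4 : Module.finrank ℚ (LinearMap.ker f) = dF N (rf x y) := by
    unfold dF; rw [← h3]
    exact (LinearEquiv.finrank_eq (Submodule.equivSubtypeMap _ _)) 
  have := cod_add N (rf x y)
  have : Module.finrank ℚ (VV N) = dV N := rfl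
  omega

def evec (x z : ℤ) : ℚ := if z = x then 1 else if z = -x then -1 else 0

theorem evec_mem {N : ℕ} {x : ℤ} (hx : x ∈ signedSet N) : evec x ∈ VV N := by
  rw [ss_iff] at hx
  refine ⟨fun z => ?_, fun z hz => ?_⟩
  · unfold evec; split_ifs <;> first | omega | simp
  · rw [ss_iff] at hz
    unfold evec; split_ifs <;> first | omega | rfl

theorem cod_lt_of_lt {N : ℕ} {a b : Equiv.Perm ℤ} (h : Fx N a < Fx N b) : cod N b + 1 ≤ cod N a := by
  have := Submodule.finrank_lt_finrank_of_lt h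
  have := cod_add N a
  have := cod_add N b
  unfold dF at *
  omega

theorem cod_left {N : ℕ} {τ : Equiv.Perm ℤ} (hτ : inB N τ) {x : ℤ} (hx : τ x ≠ x) :
    cod N (rf x (τ x) * τ) + 1 ≤ cod N τ := by
  have hxs : x ∈ signedSet N := by
    by_contra h; exact hx (hτ.2 x h)
  have hys := (inB_mem hτ).2 hxs
  have hx0 := (ss_iff.1 hxs).1
  have hy0 := (ss_iff.1 hys).1
  apply cod_lt_of_lt
  rw [SetLike.lt_iff_le_and_exists]
  constructor
  · intro v hv
    refine ⟨hv.1, fun z => ?_⟩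
    have := (mem_Fx_rf hx0 hy0 hv.1).2 (hv.2 x).symm
    rw [Equiv.Perm.mul_apply, this.2, hv.2]
  · refine ⟨evec x, ⟨evec_mem hxs, fun z => ?_⟩, fun h => ?_⟩
    · have e1 : (rf x (τ x) * τ) x = x := by rw [Equiv.Perm.mul_apply, rf_right hx0 hy0]
      have e3 := inB_mul (rf_inB hxs hys) hτ
      have e2 : (rf x (τ x) * τ) (-x) = -x := by rw [e3.1, e1]
      generalize rf x (τ x) * τ = w at *
      unfold evec
      have i1 : w z = x ↔ z = x := by rw [← w.injective.eq_iff (a := z), e1]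
      have i2 : w z = -x ↔ z = -x := by rw [← w.injective.eq_iff (a := z), e2]
      simp only [i1, i2]
    · have := h.2 x
      unfold evec at this
      rw [if_neg hx] at this
      simp at this
      split_ifs at this <;> linarith

theorem exists_list {N : ℕ} (k : ℕ) : ∀ τ : Equiv.Perm ℤ, inB N τ → cod N τ = k →
    ∃ l : List (Equiv.Perm ℤ), l.length ≤ k ∧ (∀ g ∈ l, g ∈ genB N) ∧ l.prod = τ := by
  induction k using Nat.strong_induction_on with
  | _ k ih =>
    intro τ hτ hk
    by_cases h : ∀ x, τ x = x
    · exact ⟨[], by simp, by simp, by ext x; simp [h]⟩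
    · push Not at h
      obtain ⟨x, hx⟩ := h
      have hxs : x ∈ signedSet N := by
        by_contra h; exact hx (hτ.2 x h)
      have hys := (inB_mem hτ).2 hxs
      have h1 := cod_left hτ hx
      obtain ⟨l, h2, h3, h4⟩ := ih (cod N (rf x (τ x) * τ)) (by omega) _ (inB_mul (rf_inB hxs hys) hτ) rfl
      refine ⟨rf x (τ x) :: l, by simp; omega, ?_, ?_⟩
      · intro g hg
        rcases List.mem_cons.1 hg with rfl | hg
        · exact rf_mem_gen hxs hys (Ne.symm hx)
        · exact h3 g hg
      · rw [List.prod_cons, h4, ← mul_assoc, rf_mul_self (ss_iff.1 hxs).1 (ss_iff.1 hys).1, one_mul]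

theorem lenB_eq {N : ℕ} {τ : Equiv.Perm ℤ} (hτ : inB N τ) : lenB N τ = cod N τ := by
  obtain ⟨l, h1, h2, h3⟩ := exists_list _ τ hτ rfl
  have hle : ∀ l : List (Equiv.Perm ℤ), (∀ g ∈ l, g ∈ genB N) → cod N l.prod ≤ l.length := by
    intro l
    induction l with
    | nil => intro _; simp [cod_one]
    | cons g l ih =>
      intro h
      have h1 := ih fun g hg => h g (List.mem_cons_of_mem _ hg)
      obtain ⟨x, y, hx, hy, _, rfl⟩ := gen_is_rf (h g List.mem_cons_self)
      have h2 := cod_rf (N := N) (ss_iff.1 hx).1 (ss_iff.1 hy).1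
      have h3 := cod_mul N (rf x y) l.prod
      simp only [List.prod_cons, List.length_cons]
      omega
  apply le_antisymm
  · have h5 : lenB N τ ≤ l.length := Nat.sInf_le ⟨l, rfl, h2, h3⟩
    exact h5.trans h1
  · refine le_csInf ⟨_, l, rfl, h2, h3⟩ ?_
    rintro k ⟨l', rfl, h4, rfl⟩
    exact hle l' h4

theorem Fx_inv (N : ℕ) (τ : Equiv.Perm ℤ) : Fx N τ⁻¹ = Fx N τ := by
  ext v
  constructor
  · rintro ⟨h1, h2⟩
    exact ⟨h1, fun x => by have := h2 (τ x); simpa using this.symm⟩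
  · rintro ⟨h1, h2⟩
    exact ⟨h1, fun x => by have := h2 (τ⁻¹ x); simpa using this.symm⟩

theorem cod_inv (N : ℕ) (τ : Equiv.Perm ℤ) : cod N τ⁻¹ = cod N τ := by
  unfold cod dF; rw [Fx_inv]

theorem eq_one_of_cod {N : ℕ} {τ : Equiv.Perm ℤ} (hτ : inB N τ) (h : cod N τ = 0) : τ = 1 := by
  ext x
  by_contra hx
  have := cod_left hτ hx
  omega

/-- order in terms of cod -/
theorem leB_iff {N : ℕ} {τ σ : Equiv.Perm ℤ} (hτ : inB N τ) (hσ : inB N σ) :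
    leB N τ σ ↔ cod N σ = cod N τ + cod N (τ⁻¹ * σ) := by
  unfold leB
  rw [lenB_eq hτ, lenB_eq hσ, lenB_eq (inB_mul (inB_inv hτ) hσ)]

theorem Fx_le_of_leB {N : ℕ} {τ σ : Equiv.Perm ℤ} (h : cod N σ = cod N τ + cod N (τ⁻¹ * σ)) :
    Fx N σ ≤ Fx N τ := by
  have h1 := Fx_inf_le N τ (τ⁻¹ * σ)
  rw [mul_inv_cancel_left] at h1
  have h2 := dim_inf (Fx_le N τ) (Fx_le N (τ⁻¹ * σ))
  have := cod_add N τ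
  have := cod_add N σ
  have := cod_add N (τ⁻¹ * σ)
  have h3 := Submodule.eq_of_le_of_finrank_le h1 (by unfold dF at *; omega)
  rw [← h3]; exact inf_le_left

open Equiv.Perm (SameCycle)

/-! dot product -/
noncomputable def dot (N : ℕ) (u v : ℤ → ℚ) : ℚ := ∑ x ∈ Finset.Icc (-(N:ℤ)) N, u x * v x

theorem dot_perm {N : ℕ} {τ : Equiv.Perm ℤ} (hτ : inB N τ) (u v : ℤ → ℚ) :
    dot N (fun x => u (τ x)) (fun x => v (τ x)) = dot N u v := by
  unfold dot
  refine Finset.sum_equiv τ ?_ ?_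
  · intro x
    by_cases h : x ∈ signedSet N
    · have h2 := (inB_mem hτ).2 h
      rw [ss_iff] at h h2
      simp only [Finset.mem_Icc]; omega
    · rw [hτ.2 x h]
  · intro x _; rfl

theorem dot_self_zero {N : ℕ} {v : ℤ → ℚ} (hv : v ∈ VV N) (h : dot N v v = 0) : v = 0 := by
  unfold dot at h
  rw [Finset.sum_eq_zero_iff_of_nonneg (fun _ _ => mul_self_nonneg _)] at h
  ext x
  by_cases hx : x ∈ signedSet N
  · exact mul_self_eq_zero.1 (h x (by rw [ss_iff] at hx; simp only [Finset.mem_Icc]; omega))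
  · exact hv.2 x hx

theorem bw_mem {N : ℕ} {τ σ γ : Equiv.Perm ℤ} (hτ : inB N τ) (hσ : inB N σ) (hγ : inB N γ)
    (hg : Fx N γ = ⊥) (h2 : cod N γ = cod N σ + cod N (σ⁻¹ * γ)) (hle : Fx N σ ≤ Fx N τ) :
    Fx N (τ⁻¹ * γ) ≤ Fx N (σ⁻¹ * γ) := by
  have hfx : ∀ {ρ : Equiv.Perm ℤ} {v : ℤ → ℚ}, v ∈ Fx N (ρ⁻¹ * γ) → ∀ x, v (γ⁻¹ x) = v (ρ⁻¹ x) := by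
    intro ρ v hv x
    have := hv.2 (γ⁻¹ x)
    simpa using this.symm
  have hfi : ∀ {ρ : Equiv.Perm ℤ} {v : ℤ → ℚ}, v ∈ Fx N ρ → ∀ x, v (ρ⁻¹ x) = v x := by
    intro ρ v hv x
    rw [← Fx_inv] at hv; exact hv.2 x
  have disj : Disjoint (Fx N (σ⁻¹ * γ)) (Fx N σ) := by
    rw [Submodule.disjoint_def]
    intro v h3 h4
    have : v ∈ Fx N γ := by
      rw [← Fx_inv]
      exact ⟨h3.1, fun x => by rw [hfx h3, hfi h4]⟩
    rw [hg] at this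
    exact (Submodule.mem_bot _).1 this
  have hsup : Fx N (σ⁻¹ * γ) ⊔ Fx N σ = VV N := by
    apply Submodule.eq_of_le_of_finrank_le (sup_le (Fx_le _ _) (Fx_le _ _))
    have h3 := Submodule.finrank_sup_add_finrank_inf_eq (Fx N (σ⁻¹ * γ)) (Fx N σ)
    have h4 := cod_add N σ
    have h5 := cod_add N (σ⁻¹ * γ)
    have h6 := cod_add N γ
    have h7 : dF N γ = 0 := by unfold dF; rw [hg]; simp
    rw [disj.eq_bot, finrank_bot] at h3
    change dV N ≤ _
    unfold dF at *
    omega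
  intro v hv
  have hv' : v ∈ Fx N (σ⁻¹ * γ) ⊔ Fx N σ := by rw [hsup]; exact hv.1
  obtain ⟨k, hk, f, hf, rfl⟩ := Submodule.mem_sup.1 hv'
  have hfτ := hle hf
  have hγi := inB_inv hγ
  have hτi := inB_inv hτ
  have hσi := inB_inv hσ
  -- dot identities
  have e1 : ∀ x, f (γ⁻¹ x) - f x = ((k + f) (τ⁻¹ x) - (k + f) x) - (k (σ⁻¹ x) - k x) := by
    intro x
    have a1 := hfx hv x
    have a2 := hfx hk x
    simp only [Pi.add_apply] at *
    linarith
  have e2 : dot N (fun x => (k+f) (τ⁻¹ x)) f = dot N (k+f) f := by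
    rw [← dot_perm hτi (k+f) f]
    congr 1
    ext x; exact (hfi hfτ x).symm
  have e3 : dot N (fun x => k (σ⁻¹ x)) f = dot N k f := by
    rw [← dot_perm hσi k f]
    congr 1
    ext x; exact (hfi hf x).symm
  have e4 : dot N (fun x => f (γ⁻¹ x)) f = dot N f f := by
    have : dot N (fun x => f (γ⁻¹ x)) f - dot N f f = (dot N (fun x => (k+f) (τ⁻¹ x)) f - dot N (k+f) f)
        - (dot N (fun x => k (σ⁻¹ x)) f - dot N k f) := by
      unfold dot
      simp only [← Finset.sum_sub_distrib]
      apply Finset.sum_congr rfl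
      intro x _
      linear_combination f x * e1 x
    rw [e2, e3] at this
    linarith
  have e5 : dot N (fun x => f (γ⁻¹ x) - f x) (fun x => f (γ⁻¹ x) - f x) = 0 := by
    have a1 := dot_perm hγi f f
    have : dot N (fun x => f (γ⁻¹ x) - f x) (fun x => f (γ⁻¹ x) - f x) =
      dot N (fun x => f (γ⁻¹ x)) (fun x => f (γ⁻¹ x)) - 2 * dot N (fun x => f (γ⁻¹ x)) f + dot N f f := by
      unfold dot
      rw [Finset.mul_sum, ← Finset.sum_sub_distrib, ← Finset.sum_add_distrib]
      apply Finset.sum_congr rfl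
      intro x _
      ring
    rw [this, a1, e4]; ring
  have hVd : (fun x => f (γ⁻¹ x) - f x) ∈ VV N := by
    refine ⟨fun x => ?_, fun x hx => ?_⟩
    · change f (γ⁻¹ (-x)) - f (-x) = -(f (γ⁻¹ x) - f x)
      rw [hγi.1, hf.1.1, hf.1.1]; ring
    · change f (γ⁻¹ x) - f x = 0
      rw [hγi.2 x hx]; ring
  have e6 := dot_self_zero hVd e5
  have hf0 : f ∈ Fx N γ := by
    rw [← Fx_inv]
    exact ⟨hf.1, fun x => by have := congrFun e6 x; simp only [Pi.zero_apply] at this; linarith⟩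
  rw [hg, Submodule.mem_bot] at hf0
  rw [hf0, add_zero]; exact hk

theorem bw_le {N : ℕ} {τ σ γ : Equiv.Perm ℤ} (hτ : inB N τ) (hσ : inB N σ) (hγ : inB N γ)
    (hg : Fx N γ = ⊥) (h1 : cod N γ = cod N τ + cod N (τ⁻¹ * γ))
    (h2 : cod N γ = cod N σ + cod N (σ⁻¹ * γ)) (hle : Fx N σ ≤ Fx N τ) :
    cod N σ = cod N τ + cod N (τ⁻¹ * σ) := by
  have hK := bw_mem hτ hσ hγ hg h2 hle
  have hfx : ∀ {ρ : Equiv.Perm ℤ} {v : ℤ → ℚ}, v ∈ Fx N (ρ⁻¹ * γ) → ∀ x, v (γ⁻¹ x) = v (ρ⁻¹ x) := by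
    intro ρ v hv x
    have := hv.2 (γ⁻¹ x)
    simpa using this.symm
  have disj : Disjoint (Fx N (τ⁻¹ * γ)) (Fx N σ) := by
    rw [Submodule.disjoint_def]
    intro v h3 h4
    have : v ∈ Fx N γ := by
      rw [← Fx_inv]
      refine ⟨h3.1, fun x => ?_⟩
      have h5 := hle h4
      rw [← Fx_inv] at h5
      rw [hfx h3, h5.2]
    rw [hg] at this
    exact (Submodule.mem_bot _).1 this
  have hle2 : Fx N (τ⁻¹ * γ) ⊔ Fx N σ ≤ Fx N (τ⁻¹ * σ) := by
    apply sup_le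
    · intro v hv
      refine ⟨hv.1, fun x => ?_⟩
      rw [Equiv.Perm.mul_apply, ← hfx hv, hfx (hK hv)]; simp
    · intro v hv
      refine ⟨hv.1, fun x => ?_⟩
      have h5 := hle hv
      rw [← Fx_inv] at h5
      rw [Equiv.Perm.mul_apply, h5.2, hv.2]
  have h3 := Submodule.finrank_sup_add_finrank_inf_eq (Fx N (τ⁻¹ * γ)) (Fx N σ)
  rw [disj.eq_bot, finrank_bot] at h3
  have h4 := Submodule.finrank_mono hle2
  have h5 := cod_add N σ
  have h6 := cod_add N (τ⁻¹ * γ)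
  have h7 := cod_add N γ
  have h8 := cod_add N (τ⁻¹ * σ)
  have h9 := cod_add N τ
  have h10 : dF N γ = 0 := by unfold dF; rw [hg]; simp
  have h11 := cod_mul N τ (τ⁻¹ * σ)
  rw [mul_inv_cancel_left] at h11
  unfold dF at *
  omega

/-! orbits -/
theorem sc_neg {N : ℕ} {τ : Equiv.Perm ℤ} (hτ : inB N τ) {x y : ℤ} (h : SameCycle τ x y) :
    SameCycle τ (-x) (-y) := by
  have hz : ∀ k : ℤ, ∀ x, (τ ^ k) (-x) = -((τ ^ k) x) := by
    intro k
    have hn : ∀ k : ℕ, ∀ x, (τ ^ k) (-x) = -((τ ^ k) x) := by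
      intro k
      induction k with
      | zero => intro x; simp
      | succ k ih => intro x; rw [pow_succ', Equiv.Perm.mul_apply, Equiv.Perm.mul_apply, ih, hτ.1]
    rcases k with k | k
    · intro x; simpa using hn k x
    · intro x
      rw [zpow_negSucc, Equiv.Perm.inv_eq_iff_eq, hn]; simp
  obtain ⟨k, hk⟩ := h
  exact ⟨k, by rw [hz, hk]⟩

theorem sc_mem {N : ℕ} {τ : Equiv.Perm ℤ} (hτ : inB N τ) {x y : ℤ} (h : SameCycle τ x y) :
    y ∈ signedSet N ↔ x ∈ signedSet N := by
  constructor
  · intro hy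
    by_contra hx
    have : τ x = x := hτ.2 x hx
    rw [h.eq_of_left this] at hx; exact hx hy
  · intro hx
    by_contra hy
    have : τ y = y := hτ.2 y hy
    rw [h.eq_of_right this] at hx; exact hy hx

def bal (τ : Equiv.Perm ℤ) (x : ℤ) : Prop := SameCycle τ x (-x)

theorem bal_of_sc {N : ℕ} {τ : Equiv.Perm ℤ} (hτ : inB N τ) {x y : ℤ} (h : SameCycle τ x y) (hx : bal τ x) :
    bal τ y := (h.symm.trans hx).trans (sc_neg hτ h)

theorem bal_neg {τ : Equiv.Perm ℤ} {x : ℤ} : bal τ (-x) ↔ bal τ x := by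
  unfold bal; rw [neg_neg]; exact ⟨fun h => h.symm, fun h => h.symm⟩

def rel (τ : Equiv.Perm ℤ) (x y : ℤ) : Prop := SameCycle τ x y ∨ (bal τ x ∧ bal τ y)

theorem Fx_sc {N : ℕ} {τ : Equiv.Perm ℤ} {v : ℤ → ℚ} (hv : v ∈ Fx N τ) {x y : ℤ} (h : SameCycle τ x y) :
    v x = v y := by
  have hn : ∀ k : ℕ, ∀ x, v ((τ ^ k) x) = v x := by
    intro k
    induction k with
    | zero => intro x; simp
    | succ k ih => intro x; rw [pow_succ', Equiv.Perm.mul_apply, hv.2, ih]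
  obtain ⟨k, rfl⟩ := h
  rcases k with k | k
  · simpa using (hn k x).symm
  · have := hn (k+1) ((τ ^ (Int.negSucc k)) x)
    rw [zpow_negSucc] at *
    simpa using this

theorem Fx_bal {N : ℕ} {τ : Equiv.Perm ℤ} {v : ℤ → ℚ} (hv : v ∈ Fx N τ) {x : ℤ} (h : bal τ x) : v x = 0 := by
  have := Fx_sc hv h
  rw [hv.1.1] at this
  linarith

open Classical in
noncomputable def ovec (τ : Equiv.Perm ℤ) (x z : ℤ) : ℚ :=
  (if SameCycle τ x z then 1 else 0) - (if SameCycle τ x (-z) then 1 else 0)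

theorem ovec_mem {N : ℕ} {τ : Equiv.Perm ℤ} (hτ : inB N τ) {x : ℤ} (hx : x ∈ signedSet N) : ovec τ x ∈ Fx N τ := by
  refine ⟨⟨fun z => ?_, fun z hz => ?_⟩, fun z => ?_⟩
  · unfold ovec; rw [neg_neg]; ring
  · unfold ovec
    rw [if_neg, if_neg, sub_zero]
    · intro h; exact hz (ss_neg.1 ((sc_mem hτ h).2 hx))
    · intro h; exact hz ((sc_mem hτ h).2 hx)
  · unfold ovec
    have h1 : SameCycle τ x (τ z) ↔ SameCycle τ x z := Equiv.Perm.sameCycle_apply_right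
    have h2 : SameCycle τ x (-(τ z)) ↔ SameCycle τ x (-z) := by
      rw [← hτ.1]; exact Equiv.Perm.sameCycle_apply_right
    have e1 := propext h1
    have e2 := propext h2
    congr 1
    · by_cases a : SameCycle τ x z
      · rw [if_pos (h1.2 a), if_pos a]
      · rw [if_neg (mt h1.1 a), if_neg a]
    · by_cases a : SameCycle τ x (-z)
      · rw [if_pos (h2.2 a), if_pos a]
      · rw [if_neg (mt h2.1 a), if_neg a]

theorem ovec_self {τ : Equiv.Perm ℤ} {x : ℤ} (hx : ¬ bal τ x) : ovec τ x x = 1 := by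
  unfold ovec
  have hx' : ¬ SameCycle τ x (-x) := hx
  rw [if_pos (SameCycle.refl τ x), if_neg hx', sub_zero]

theorem ovec_eq_one {τ : Equiv.Perm ℤ} {x y : ℤ} (h : ovec τ x y = 1) : SameCycle τ x y := by
  unfold ovec at h
  by_contra h2
  rw [if_neg h2] at h
  split_ifs at h <;> linarith

theorem rel_iff {N : ℕ} {τ : Equiv.Perm ℤ} (hτ : inB N τ) {x y : ℤ} (hx : x ∈ signedSet N) (hy : y ∈ signedSet N) :
    rel τ x y ↔ ∀ v ∈ Fx N τ, v x = v y := by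
  constructor
  · rintro (h | ⟨h1, h2⟩) v hv
    · exact Fx_sc hv h
    · rw [Fx_bal hv h1, Fx_bal hv h2]
  · intro h
    by_cases hbx : bal τ x
    · by_cases hby : bal τ y
      · exact Or.inr ⟨hbx, hby⟩
      · have := h _ (ovec_mem hτ hy)
        rw [ovec_self hby] at this
        exact Or.inl (ovec_eq_one this).symm
    · have := h _ (ovec_mem hτ hx)
      rw [ovec_self hbx] at this
      exact Or.inl (ovec_eq_one this.symm)

theorem Fx_le_iff {N : ℕ} {τ σ : Equiv.Perm ℤ} (hτ : inB N τ) (hσ : inB N σ) :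
    Fx N σ ≤ Fx N τ ↔ ∀ x y, x ∈ signedSet N → y ∈ signedSet N → rel τ x y → rel σ x y := by
  constructor
  · intro h x y hx hy hr
    rw [rel_iff hσ hx hy]
    intro v hv
    exact (rel_iff hτ hx hy).1 hr v (h hv)
  · intro h v hv
    refine ⟨hv.1, fun x => ?_⟩
    by_cases hx : x ∈ signedSet N
    · have hy := (inB_mem hτ).2 hx
      exact ((rel_iff hσ hx hy).1 (h x _ hx hy (Or.inl (Equiv.Perm.sameCycle_apply_right.2 (SameCycle.refl _ _)))) v hv).symm
    · rw [hτ.2 x hx]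

theorem rel_refl (τ : Equiv.Perm ℤ) (x : ℤ) : rel τ x x := Or.inl (SameCycle.refl _ _)

theorem omega_eq {N : ℕ} {τ : Equiv.Perm ℤ} (hτ : inB N τ) :
    omegaTilde N τ = {A | ∃ x ∈ signedSet N, A = {y | y ∈ signedSet N ∧ rel τ x y}} := by
  have hneg : ∀ x, negSet (permOrbit τ x) = permOrbit τ x ↔ bal τ x := by
    intro x
    constructor
    · intro h
      have : x ∈ negSet (permOrbit τ x) := by rw [h]; exact SameCycle.refl τ x
      exact this
    · intro h
      ext z
      change SameCycle τ x (-z) ↔ SameCycle τ x z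
      constructor
      · intro h2; have := sc_neg hτ h2; rw [neg_neg] at this; exact h.trans this
      · intro h2; exact h.trans (sc_neg hτ h2)
  have hU : ∀ z, z ∈ ⋃₀ {A | A ∈ orbitsOn N τ ∧ negSet A = A} ↔ z ∈ signedSet N ∧ bal τ z := by
    intro z
    constructor
    · rintro ⟨A, ⟨⟨x, hx, rfl⟩, h⟩, hz⟩
      rw [hneg] at h
      have hz' : SameCycle τ x z := hz
      exact ⟨(sc_mem hτ hz').2 hx, bal_of_sc hτ hz' h⟩
    · rintro ⟨hz, hb⟩
      exact ⟨permOrbit τ z, ⟨⟨z, hz, rfl⟩, (hneg z).2 hb⟩, SameCycle.refl τ z⟩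
  ext A
  constructor
  · rintro (⟨⟨x, hx, rfl⟩, h⟩ | ⟨rfl, ⟨x, hx⟩⟩)
    · refine ⟨x, hx, ?_⟩
      rw [Ne, hneg] at h
      ext y
      constructor
      · intro hy
        have hy' : SameCycle τ x y := hy
        exact ⟨(sc_mem hτ hy').2 hx, Or.inl hy'⟩
      · rintro ⟨_, h2 | h2⟩
        · exact h2
        · exact absurd h2.1 h
    · have hx' := (hU x).1 hx
      refine ⟨x, hx'.1, ?_⟩
      ext y
      rw [hU]
      constructor
      · rintro ⟨h1, h2⟩; exact ⟨h1, Or.inr ⟨hx'.2, h2⟩⟩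
      · rintro ⟨h1, h2 | h2⟩
        · exact ⟨h1, bal_of_sc hτ h2 hx'.2⟩
        · exact ⟨h1, h2.2⟩
  · rintro ⟨x, hx, rfl⟩
    by_cases h : bal τ x
    · right
      refine ⟨?_, x, hx, rel_refl _ _⟩
      ext y
      rw [hU]
      constructor
      · rintro ⟨h1, h2 | h2⟩
        · exact ⟨h1, bal_of_sc hτ h2 h⟩
        · exact ⟨h1, h2.2⟩
      · rintro ⟨h1, h2⟩; exact ⟨h1, Or.inr ⟨h, h2⟩⟩
    · left
      have e : {y | y ∈ signedSet N ∧ rel τ x y} = permOrbit τ x := by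
        ext y
        constructor
        · rintro ⟨_, h2 | h2⟩
          · exact h2
          · exact absurd h2.1 h
        · intro hy
          have hy' : SameCycle τ x y := hy
          exact ⟨(sc_mem hτ hy').2 hx, Or.inl hy'⟩
      rw [e]
      exact ⟨⟨x, hx, rfl⟩, by rw [Ne, hneg]; exact h⟩

theorem rel_symm {τ : Equiv.Perm ℤ} {x y : ℤ} (h : rel τ x y) : rel τ y x := by
  rcases h with h | h
  · exact Or.inl h.symm
  · exact Or.inr h.symm

theorem rel_trans {N : ℕ} {τ : Equiv.Perm ℤ} (hτ : inB N τ) {x y z : ℤ} (h : rel τ x y) (h2 : rel τ y z) : rel τ x z := by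
  rcases h with h | h <;> rcases h2 with h2 | h2
  · exact Or.inl (h.trans h2)
  · exact Or.inr ⟨bal_of_sc hτ h.symm h2.1, h2.2⟩
  · exact Or.inr ⟨h.1, bal_of_sc hτ h2 h.2⟩
  · exact Or.inr ⟨h.1, h2.2⟩

theorem refines_iff {N : ℕ} {τ σ : Equiv.Perm ℤ} (hτ : inB N τ) (hσ : inB N σ) :
    refines (omegaTilde N τ) (omegaTilde N σ) ↔ Fx N σ ≤ Fx N τ := by
  rw [Fx_le_iff hτ hσ, omega_eq hτ, omega_eq hσ]
  constructor
  · intro h x y hx hy hr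
    obtain ⟨B, ⟨z, hz, rfl⟩, hB⟩ := h _ ⟨x, hx, rfl⟩
    have h1 := hB ⟨hx, rel_refl _ _⟩
    have h2 := hB ⟨hy, hr⟩
    exact rel_trans hσ (rel_symm h1.2) h2.2
  · rintro h A ⟨x, hx, rfl⟩
    exact ⟨_, ⟨x, hx, rfl⟩, fun y hy => ⟨hy.1, h x y hx hy.1 hy.2⟩⟩


theorem finite_inB (k : ℕ) : {τ : Equiv.Perm ℤ | inB k τ}.Finite := by
  have key : ∀ τ : Equiv.Perm ℤ, inB k τ → ∀ x ∈ Finset.Icc (-(k:ℤ)) k, τ x ∈ Finset.Icc (-(k:ℤ)) k := by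
    intro τ hτ x hx
    by_cases h : x ∈ signedSet k
    · have := (inB_mem hτ).2 h
      rw [ss_iff] at this
      rw [Finset.mem_Icc]; omega
    · rw [hτ.2 x h]; exact hx
  have : Finite {τ : Equiv.Perm ℤ | inB k τ} := by
    refine Finite.of_injective (β := Finset.Icc (-(k:ℤ)) k → Finset.Icc (-(k:ℤ)) k)
      (fun τ x => ⟨τ.1 x.1, key τ.1 τ.2 x.1 x.2⟩) ?_
    rintro ⟨a, ha⟩ ⟨b, hb⟩ h
    simp only [Subtype.mk.injEq]
    ext x
    by_cases hx : x ∈ signedSet k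
    · have hx2 : x ∈ Finset.Icc (-(k:ℤ)) k := by rw [ss_iff] at hx; rw [Finset.mem_Icc]; omega
      have := congrFun h ⟨x, hx2⟩
      simpa using this
    · rw [ha.2 x hx, hb.2 x hx]
  exact Set.toFinite _

noncomputable def BF (k : ℕ) : Finset (Equiv.Perm ℤ) := (finite_inB k).toFinset

theorem mem_BF {k : ℕ} {τ : Equiv.Perm ℤ} : τ ∈ BF k ↔ inB k τ := by simp [BF]

abbrev GA := MonoidAlgebra (Polynomial ℝ) (Equiv.Perm ℤ)

noncomputable def Sf' (k : ℕ) : Finset ℤ := (Finset.Icc (-(k:ℤ)) k).erase 0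
noncomputable def Sf (k : ℕ) : Finset ℤ := (Sf' k).erase k

theorem mem_Sf' {k : ℕ} {a : ℤ} : a ∈ Sf' k ↔ a ∈ signedSet k := by
  simp [Sf', ss_iff]
theorem mem_Sf {k : ℕ} {a : ℤ} : a ∈ Sf k ↔ a ≠ k ∧ a ∈ signedSet k := by
  simp [Sf, mem_Sf']

noncomputable def EE (N k : ℕ) : GA := ∑ τ ∈ BF k, MonoidAlgebra.single τ (Polynomial.X ^ cod N τ)
noncomputable def JJ (k : ℕ) : GA := ∑ a ∈ Sf k, MonoidAlgebra.single (rf k a) Polynomial.X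

theorem rf_same (x : ℤ) (hx : x ≠ 0) : rf x x = 1 := by
  ext z; rw [rf_apply hx hx]; simp only [Equiv.Perm.one_apply]; split_ifs <;> omega

theorem rf_conj {τ : Equiv.Perm ℤ} (hodd : ∀ x, τ (-x) = -τ x) {n a : ℤ} (hn : τ n = n) (hn0 : n ≠ 0) (ha : a ≠ 0)
    (hta : τ a ≠ 0) : τ * rf n a = rf n (τ a) * τ := by
  ext z
  simp only [Equiv.Perm.mul_apply]
  rw [rf_apply hn0 ha, rf_apply hn0 hta]
  have e1 : τ z = n ↔ z = n := by
    constructor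
    · intro h; rw [← hn] at h; exact τ.injective h
    · rintro rfl; exact hn
  have e2 : τ z = τ a ↔ z = a := τ.injective.eq_iff
  have e3 : τ z = -n ↔ z = -n := by
    constructor
    · intro h; apply τ.injective; rw [h, hodd, hn]
    · rintro rfl; rw [hodd, hn]
  have e4 : τ z = -τ a ↔ z = -a := by
    rw [← hodd, τ.injective.eq_iff]
  simp only [e1, e2, e3, e4]
  split_ifs <;> simp [hn, hodd]

theorem cod_mul_rf_ge {N : ℕ} (w : Equiv.Perm ℤ) {x y : ℤ} (hx : x ≠ 0) (hy : y ≠ 0) :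
    cod N w ≤ cod N (w * rf x y) + 1 := by
  have h := cod_mul N (w * rf x y) (rf x y)
  rw [mul_assoc, rf_mul_self hx hy, mul_one] at h
  have := cod_rf (N := N) hx hy
  omega

theorem n_mem (k : ℕ) : ((k + 1 : ℕ) : ℤ) ∈ signedSet (k+1) := by
  rw [ss_iff]; push_cast; omega

theorem inB_pred {k : ℕ} {τ : Equiv.Perm ℤ} (h : inB (k+1) τ) (hn : τ ((k + 1 : ℕ) : ℤ) = ((k + 1 : ℕ) : ℤ)) : inB k τ := by
  refine ⟨h.1, fun x hx => ?_⟩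
  by_cases h2 : x ∈ signedSet (k+1)
  · rw [ss_iff] at h2 hx
    have : x = ((k + 1 : ℕ) : ℤ) ∨ x = -((k + 1 : ℕ) : ℤ) := by push_cast at *; omega
    rcases this with rfl | rfl
    · exact hn
    · rw [h.1, hn]
  · exact h.2 x h2

theorem one_add_JJ (k : ℕ) : 1 + JJ (k+1) = ∑ a ∈ Sf' (k+1),
    (MonoidAlgebra.single (rf ((k+1 : ℕ) : ℤ) a) (if a = ((k+1 : ℕ) : ℤ) then 1 else Polynomial.X) : GA) := by
  have h : ((k+1 : ℕ) : ℤ) ∈ Sf' (k+1) := mem_Sf'.2 (n_mem k)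
  rw [← Finset.add_sum_erase _ _ h, rf_same _ (by push_cast; omega), if_pos rfl]
  congr 1
  unfold JJ Sf
  refine Finset.sum_congr rfl fun a ha => ?_
  rw [if_neg (Finset.mem_erase.1 ha).1]

theorem EE_succ {N k : ℕ} (hk : k + 1 ≤ N) : EE N (k+1) = EE N k * (1 + JJ (k+1)) := by
  rw [one_add_JJ]
  unfold EE
  rw [Finset.sum_mul_sum, ← Finset.sum_product']
  symm
  have hn0 : ((k+1 : ℕ) : ℤ) ≠ 0 := by push_cast; omega
  have hn := n_mem k
  have hfix : ∀ τ, inB k τ → τ ((k+1 : ℕ) : ℤ) = ((k+1 : ℕ) : ℤ) := by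
    intro τ h; apply h.2; rw [ss_iff]; push_cast; omega
  refine Finset.sum_bij' (fun q _ => q.1 * rf ((k+1 : ℕ) : ℤ) q.2)
    (fun τ _ => (τ * rf ((k+1 : ℕ) : ℤ) (τ⁻¹ ((k+1 : ℕ) : ℤ)), τ⁻¹ ((k+1 : ℕ) : ℤ))) ?_ ?_ ?_ ?_ ?_
  · rintro ⟨τ, a⟩ h
    rw [Finset.mem_product, mem_BF, mem_Sf'] at h
    rw [mem_BF]
    exact inB_mul (inB_mono (by omega) h.1) (rf_inB hn h.2)
  · intro τ h
    rw [mem_BF] at h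
    have hs : τ⁻¹ ((k+1 : ℕ) : ℤ) ∈ signedSet (k+1) := (inB_mem (inB_inv h)).2 hn
    rw [Finset.mem_product, mem_BF, mem_Sf']
    refine ⟨inB_pred (inB_mul h (rf_inB hn hs)) ?_, hs⟩
    simp only [Equiv.Perm.mul_apply]
    rw [rf_left hn0 (by rw [ss_iff] at hs; exact hs.1)]; simp
  · rintro ⟨τ, a⟩ h
    rw [Finset.mem_product, mem_BF, mem_Sf'] at h
    have ha : a ≠ 0 := by have := h.2; rw [ss_iff] at this; exact this.1
    have e : (τ * rf ((k+1 : ℕ) : ℤ) a)⁻¹ ((k+1 : ℕ) : ℤ) = a := by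
      rw [Equiv.Perm.inv_eq_iff_eq]
      simp only [Equiv.Perm.mul_apply]
      rw [rf_right hn0 ha, hfix _ h.1]
    simp only [e]
    rw [mul_assoc, rf_mul_self hn0 ha, mul_one]
  · intro τ h
    rw [mem_BF] at h
    have hs : τ⁻¹ ((k+1 : ℕ) : ℤ) ∈ signedSet (k+1) := (inB_mem (inB_inv h)).2 hn
    simp only
    rw [mul_assoc, rf_mul_self hn0 (by rw [ss_iff] at hs; exact hs.1), mul_one]
  · rintro ⟨τ, a⟩ h
    rw [Finset.mem_product, mem_BF, mem_Sf'] at h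
    have ha : a ≠ 0 := by have := h.2; rw [ss_iff] at this; exact this.1
    simp only [MonoidAlgebra.single_mul_single]
    congr 1
    by_cases hb : a = ((k+1 : ℕ) : ℤ)
    · rw [if_pos hb, hb, rf_same _ hn0, mul_one, mul_one]
    · rw [if_neg hb, ← pow_succ]
      congr 1
      simp only at h
      have h1 := cod_mul_rf_ge (N := N) τ hn0 ha
      have h2 := cod_mul N τ (rf ((k+1 : ℕ) : ℤ) a)
      have h3 := cod_rf (N := N) hn0 ha
      have hB : inB N (τ * rf ((k+1 : ℕ) : ℤ) a) := inB_mono hk (inB_mul (inB_mono (by omega) h.1) (rf_inB hn h.2))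
      have e : (τ * rf ((k+1 : ℕ) : ℤ) a)⁻¹ ((k+1 : ℕ) : ℤ) = a := by
        rw [Equiv.Perm.inv_eq_iff_eq]
        simp only [Equiv.Perm.mul_apply]
        rw [rf_right hn0 ha, hfix _ h.1]
      have h4 := cod_left (inB_inv hB) (x := ((k+1 : ℕ) : ℤ)) (by rw [e]; exact hb)
      rw [e, mul_inv_rev, rf_inv hn0 ha, ← mul_assoc, rf_mul_self hn0 ha, one_mul, cod_inv] at h4
      rw [show rf ((k+1 : ℕ) : ℤ) a * τ⁻¹ = (τ * rf ((k+1 : ℕ) : ℤ) a)⁻¹ by rw [mul_inv_rev, rf_inv hn0 ha], cod_inv] at h4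
      omega

theorem EE_comm (N k : ℕ) : Commute (EE N k) (JJ (k+1)) := by
  unfold EE
  refine Commute.sum_left _ _ _ fun τ hτ => ?_
  rw [mem_BF] at hτ
  have hfix : τ ((k+1 : ℕ) : ℤ) = ((k+1 : ℕ) : ℤ) := by
    apply hτ.2; rw [ss_iff]; push_cast; omega
  unfold Commute SemiconjBy JJ
  rw [Finset.mul_sum, Finset.sum_mul]
  have hB : inB (k+1) τ := inB_mono (by omega) hτ
  refine Finset.sum_equiv τ ?_ ?_
  · intro a
    rw [mem_Sf, mem_Sf, inB_mem hB]
    constructor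
    · rintro ⟨h1, h2⟩
      exact ⟨fun h => h1 (τ.injective (h.trans hfix.symm)), h2⟩
    · rintro ⟨h1, h2⟩
      exact ⟨fun h => h1 (by rw [h, hfix]), h2⟩
  · intro a ha
    have h1 := (mem_Sf.1 ha).2
    have h2 := (inB_mem hB).2 h1
    rw [ss_iff] at h1 h2
    rw [MonoidAlgebra.single_mul_single, MonoidAlgebra.single_mul_single,
      rf_conj hτ.1 hfix (by push_cast; omega) h1.1 h2.1, mul_comm (Polynomial.X)]

theorem EE_pow {N k : ℕ} (hk : k + 1 ≤ N) (m : ℕ) :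
    EE N (k+1) ^ m = ∑ j ∈ Finset.range (m+1), (m.choose j : GA) * (EE N k ^ m * JJ (k+1) ^ j) := by
  have hc : Commute (EE N k) (1 + JJ (k+1)) := (Commute.one_right _).add_right (EE_comm N k)
  rw [EE_succ hk, hc.mul_pow, add_comm (1:GA), (Commute.one_right (JJ (k+1))).add_pow, Finset.mul_sum]
  refine Finset.sum_congr rfl fun j _ => ?_
  rw [one_pow, mul_one, ← mul_assoc, (Nat.cast_commute (m.choose j) _).eq]

noncomputable def ld (N : ℕ) (u : GA) (w : Equiv.Perm ℤ) : ℝ := (u.coeff w).coeff (cod N w)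
def Gd (N : ℕ) (u : GA) : Prop := ∀ w d, d < cod N w → (u.coeff w).coeff d = 0

theorem Gd_add {N : ℕ} {u v : GA} (hu : Gd N u) (hv : Gd N v) : Gd N (u + v) := by
  intro w d h
  simp [hu w d h, hv w d h]
theorem Gd_sum {N : ℕ} {ι : Type} (s : Finset ι) (f : ι → GA) (hu : ∀ i ∈ s, Gd N (f i)) : Gd N (∑ i ∈ s, f i) := by
  classical
  induction s using Finset.induction_on with
  | empty => intro w d h; simp
  | insert a s ha ih =>
    rw [Finset.sum_insert ha]
    exact Gd_add (hu a (by simp)) (ih fun i hi => hu i (by simp [hi]))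
theorem ld_add (N : ℕ) (u v : GA) (w : Equiv.Perm ℤ) : ld N (u + v) w = ld N u w + ld N v w := by
  simp [ld]
theorem ld_sum (N : ℕ) {ι : Type} (s : Finset ι) (f : ι → GA) (w : Equiv.Perm ℤ) :
    ld N (∑ i ∈ s, f i) w = ∑ i ∈ s, ld N (f i) w := by
  classical
  induction s using Finset.induction_on with
  | empty => simp [ld]
  | insert a s ha ih =>
    rw [Finset.sum_insert ha, Finset.sum_insert ha, ld_add, ih]
theorem ld_nat (N c : ℕ) (u : GA) (w : Equiv.Perm ℤ) : ld N ((c : GA) * u) w = c * ld N u w := by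
  rw [← nsmul_eq_mul]
  unfold ld
  rw [MonoidAlgebra.coeff_smul_apply, Polynomial.coeff_smul, nsmul_eq_mul]

theorem mul_single_coeff (u : GA) (t w : Equiv.Perm ℤ) (e d : ℕ) :
    ((u * MonoidAlgebra.single t (Polynomial.X ^ e)).coeff w).coeff d =
      if e ≤ d then (u.coeff (w * t⁻¹)).coeff (d - e) else 0 := by
  rw [MonoidAlgebra.coeff_mul_single_apply, Polynomial.coeff_mul_X_pow']

theorem Gd_single {N : ℕ} {u : GA} (hu : Gd N u) {t : Equiv.Perm ℤ} {e : ℕ} (he : cod N t ≤ e) :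
    Gd N (u * MonoidAlgebra.single t (Polynomial.X ^ e)) := by
  intro w d h
  rw [mul_single_coeff]
  split_ifs with h2
  · apply hu
    have := cod_mul N (w * t⁻¹) t
    rw [inv_mul_cancel_right] at this
    omega
  · rfl

theorem ld_single {N : ℕ} {u : GA} (hu : Gd N u) {t : Equiv.Perm ℤ} {e : ℕ} (he : cod N t ≤ e) (w : Equiv.Perm ℤ) :
    ld N (u * MonoidAlgebra.single t (Polynomial.X ^ e)) w =
      if cod N (w * t⁻¹) + e = cod N w then ld N u (w * t⁻¹) else 0 := by
  unfold ld
  rw [mul_single_coeff]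
  have := cod_mul N (w * t⁻¹) t
  rw [inv_mul_cancel_right] at this
  split_ifs with h1 h2 h2
  · congr 1; omega
  · apply hu; omega
  · omega
  · rfl

theorem Gd_EE {N : ℕ} {u : GA} (hu : Gd N u) (k : ℕ) : Gd N (u * EE N k) := by
  unfold EE
  rw [Finset.mul_sum]
  exact Gd_sum _ _ fun τ _ => Gd_single hu le_rfl

theorem ld_EE {N : ℕ} {u : GA} (hu : Gd N u) (k : ℕ) (w : Equiv.Perm ℤ) : ld N (u * EE N k) w =
    ∑ τ ∈ BF k, if cod N (w * τ⁻¹) + cod N τ = cod N w then ld N u (w * τ⁻¹) else 0 := by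
  unfold EE
  rw [Finset.mul_sum, ld_sum]
  exact Finset.sum_congr rfl fun τ _ => ld_single hu le_rfl w

theorem JJ_eq (k : ℕ) : JJ k = ∑ a ∈ Sf k, MonoidAlgebra.single (rf k a) (Polynomial.X ^ 1) := by
  simp [JJ]

theorem cod_rf' {N k : ℕ} {a : ℤ} (ha : a ∈ Sf k) : cod N (rf k a) ≤ 1 := by
  have := (mem_Sf.1 ha).2
  rw [ss_iff] at this
  exact cod_rf (by omega) this.1

theorem Gd_JJ {N : ℕ} {u : GA} (hu : Gd N u) (k : ℕ) : Gd N (u * JJ k) := by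
  rw [JJ_eq, Finset.mul_sum]
  exact Gd_sum _ _ fun τ h => Gd_single hu (cod_rf' h)

theorem ld_JJ {N : ℕ} {u : GA} (hu : Gd N u) (k : ℕ) (w : Equiv.Perm ℤ) : ld N (u * JJ k) w =
    ∑ a ∈ Sf k, if cod N (w * rf k a) + 1 = cod N w then ld N u (w * rf k a) else 0 := by
  rw [JJ_eq, Finset.mul_sum, ld_sum]
  refine Finset.sum_congr rfl fun a h => ?_
  rw [ld_single hu (cod_rf' h)]
  have := (mem_Sf.1 h).2
  rw [ss_iff] at this
  rw [rf_inv (by omega) this.1]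

theorem Gd_one (N : ℕ) : Gd N 1 := by
  intro w d h
  have : w ≠ 1 := by rintro rfl; rw [cod_one] at h; omega
  rw [MonoidAlgebra.one_def, MonoidAlgebra.coeff_single, Finsupp.single_eq_of_ne this]
  simp

theorem ld_one (N : ℕ) : ld N 1 1 = 1 := by
  unfold ld
  rw [MonoidAlgebra.one_def, MonoidAlgebra.coeff_single, Finsupp.single_eq_same, cod_one]; simp

theorem Gd_EEpow (N k m : ℕ) : Gd N (EE N k ^ m) := by
  induction m with
  | zero => rw [pow_zero]; exact Gd_one N
  | succ m ih => rw [pow_succ]; exact Gd_EE ih k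

noncomputable def FF (N m k : ℕ) (w : Equiv.Perm ℤ) : ℝ := ld N (EE N k ^ m) w
noncomputable def PP (N m k j : ℕ) (w : Equiv.Perm ℤ) : ℝ := ld N (EE N k ^ m * JJ (k+1) ^ j) w

theorem Gd_PP (N m k j : ℕ) : Gd N (EE N k ^ m * JJ (k+1) ^ j) := by
  induction j with
  | zero => rw [pow_zero, mul_one]; exact Gd_EEpow N k m
  | succ j ih => rw [pow_succ, ← mul_assoc]; exact Gd_JJ ih _

theorem FF_succ {N k : ℕ} (hk : k + 1 ≤ N) (m : ℕ) (w : Equiv.Perm ℤ) :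
    FF N m (k+1) w = ∑ j ∈ Finset.range (m+1), (m.choose j : ℝ) * PP N m k j w := by
  unfold FF PP
  rw [EE_pow hk, ld_sum]
  exact Finset.sum_congr rfl fun j _ => ld_nat _ _ _ _

theorem PP_zero (N m k : ℕ) (w : Equiv.Perm ℤ) : PP N m k 0 w = FF N m k w := by
  unfold PP FF; rw [pow_zero, mul_one]

theorem PP_succ (N m k j : ℕ) (w : Equiv.Perm ℤ) : PP N m k (j+1) w =
    ∑ a ∈ Sf (k+1), if cod N (w * rf ((k+1 : ℕ) : ℤ) a) + 1 = cod N w then PP N m k j (w * rf ((k+1 : ℕ) : ℤ) a) else 0 := by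
  unfold PP
  rw [pow_succ, ← mul_assoc, ld_JJ (Gd_PP N m k j)]

theorem supp_EEpow (N k m : ℕ) : ∀ w, ¬ inB k w → (EE N k ^ m).coeff w = 0 := by
  induction m with
  | zero =>
    intro w hw
    rw [pow_zero, MonoidAlgebra.one_def, MonoidAlgebra.coeff_single, Finsupp.single_eq_of_ne]
    rintro rfl; exact hw (inB_one k)
  | succ m ih =>
    intro w hw
    rw [pow_succ, EE, Finset.mul_sum, MonoidAlgebra.coeff_sum, Finsupp.finsetSum_apply]
    refine Finset.sum_eq_zero fun τ hτ => ?_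
    rw [MonoidAlgebra.coeff_mul_single_apply]
    rw [← EE, ih, zero_mul]
    intro h
    have := inB_mul h (mem_BF.1 hτ)
    rw [inv_mul_cancel_right] at this
    exact hw this

theorem FF_not {N k m : ℕ} {w : Equiv.Perm ℤ} (hw : ¬ inB k w) : FF N m k w = 0 := by
  unfold FF ld; rw [supp_EEpow N k m w hw]; simp

theorem inB_zero {w : Equiv.Perm ℤ} (hw : inB 0 w) : w = 1 := by
  ext x; apply hw.2; rw [ss_iff]; push_cast; omega

theorem FF_base (N m : ℕ) : FF N m 0 1 = 1 := by
  have : EE N 0 = 1 := by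
    have : BF 0 = {1} := by
      ext w; rw [mem_BF, Finset.mem_singleton]
      exact ⟨inB_zero, fun h => h ▸ inB_one 0⟩
    unfold EE; rw [this, Finset.sum_singleton, cod_one, pow_zero]; rfl
  unfold FF
  rw [this, one_pow, ld_one]


def LE' (N : ℕ) (a b : Equiv.Perm ℤ) : Prop := cod N b = cod N a + cod N (a⁻¹ * b)

theorem LE_refl (N : ℕ) (a : Equiv.Perm ℤ) : LE' N a a := by
  unfold LE'; rw [inv_mul_cancel, cod_one]; omega

theorem LE_trans {N : ℕ} {a b c : Equiv.Perm ℤ} (h1 : LE' N a b) (h2 : LE' N b c) : LE' N a c := by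
  unfold LE' at *
  have h3 := cod_mul N (a⁻¹ * b) (b⁻¹ * c)
  rw [mul_assoc, mul_inv_cancel_left] at h3
  have h4 := cod_mul N a (a⁻¹ * c)
  rw [mul_inv_cancel_left] at h4
  omega

theorem FF_one {N : ℕ} {w : Equiv.Perm ℤ} (hw : inB N w) : FF N 1 N w = 1 := by
  unfold FF
  rw [pow_one]
  unfold EE
  rw [ld_sum, Finset.sum_eq_single w]
  · unfold ld
    rw [MonoidAlgebra.coeff_single, Finsupp.single_eq_same]; simp
  · intro b _ hb
    unfold ld
    rw [MonoidAlgebra.coeff_single, Finsupp.single_eq_of_ne (Ne.symm hb)]; simp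
  · intro h; exact absurd (mem_BF.2 hw) h

open Classical in
theorem FF_step {N : ℕ} (j : ℕ) {w : Equiv.Perm ℤ} (hw : inB N w) : FF N (j+1) N w =
    ∑ σ ∈ BF N with LE' N σ w, FF N j N σ := by
  unfold FF
  rw [pow_succ, ld_EE (Gd_EEpow N N j), Finset.sum_filter]
  refine Finset.sum_bij' (fun τ _ => w * τ⁻¹) (fun σ _ => σ⁻¹ * w) ?_ ?_ ?_ ?_ ?_
  · intro τ h; rw [mem_BF] at *; exact inB_mul hw (inB_inv h)
  · intro τ h; rw [mem_BF] at *; exact inB_mul (inB_inv h) hw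
  · intro τ h; simp
  · intro τ h; simp
  · intro τ h
    have e : LE' N (w * τ⁻¹) w ↔ cod N (w * τ⁻¹) + cod N τ = cod N w := by
      unfold LE'
      rw [mul_inv_rev, inv_inv, inv_mul_cancel_right]; exact eq_comm
    by_cases h2 : LE' N (w * τ⁻¹) w
    · rw [if_pos (e.1 h2), if_pos h2]
    · rw [if_neg (mt e.2 h2), if_neg h2]

open Classical in
noncomputable def chF (N : ℕ) : (j : ℕ) → Equiv.Perm ℤ → Finset (Fin j → Equiv.Perm ℤ)
  | 0, _ => {Fin.elim0}
  | j+1, w => ({σ ∈ BF N | LE' N σ w}).biUnion fun σ => (chF N j σ).image fun f => Fin.snoc (α := fun _ => Equiv.Perm ℤ) f σ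

theorem card_chF (N j : ℕ) : ∀ w, inB N w → FF N (j+1) N w = (chF N j w).card := by
  classical
  induction j with
  | zero => intro w hw; rw [FF_one hw]; simp [chF]
  | succ j ih =>
    intro w hw
    rw [FF_step _ hw, chF, Finset.card_biUnion]
    · push_cast
      refine Finset.sum_congr rfl fun σ hσ => ?_
      rw [Finset.mem_filter, mem_BF] at hσ
      rw [ih σ hσ.1, Finset.card_image_of_injective]
      intro f g h
      exact (Fin.snoc_inj.1 h).1
    · intro a _ b _ hab
      rw [Function.onFun, Finset.disjoint_left]
      intro f hf hg
      obtain ⟨f1, _, h1⟩ := Finset.mem_image.1 hf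
      obtain ⟨f2, _, h2⟩ := Finset.mem_image.1 hg
      rw [← h1] at h2
      exact hab (Fin.snoc_inj.1 h2).2.symm

theorem mem_chF (N j : ℕ) : ∀ w (f : Fin j → Equiv.Perm ℤ), f ∈ chF N j w ↔
    (∀ i, inB N (f i)) ∧ (∀ i k, i ≤ k → LE' N (f i) (f k)) ∧ ∀ i, LE' N (f i) w := by
  classical
  induction j with
  | zero =>
    intro w f
    simp only [chF, Finset.mem_singleton]
    refine ⟨fun _ => ⟨fun i => i.elim0, fun i => i.elim0, fun i => i.elim0⟩, fun _ => ?_⟩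
    ext i; exact i.elim0
  | succ j ih =>
    intro w f
    rw [chF, Finset.mem_biUnion]
    constructor
    · rintro ⟨σ, hσ, hf⟩
      obtain ⟨g, hg, rfl⟩ := Finset.mem_image.1 hf
      rw [Finset.mem_filter, mem_BF] at hσ
      obtain ⟨h1, h2, h3⟩ := (ih σ g).1 hg
      refine ⟨fun i => ?_, fun i k => ?_, fun i => ?_⟩
      · refine Fin.lastCases ?_ (fun i => ?_) i
        · simpa using hσ.1
        · simpa using h1 i
      · refine Fin.lastCases ?_ (fun i => ?_) i
        · refine Fin.lastCases ?_ (fun k => ?_) k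
          · intro _; exact LE_refl _ _
          · intro h; exact absurd h (by simp [Fin.le_def])
        · refine Fin.lastCases ?_ (fun k => ?_) k
          · intro _; simpa using h3 i
          · intro h; simpa using h2 i k (by simpa using h)
      · refine Fin.lastCases ?_ (fun i => ?_) i
        · simpa using hσ.2
        · simpa using LE_trans (h3 i) hσ.2
    · rintro ⟨h1, h2, h3⟩
      refine ⟨f (Fin.last j), ?_, Finset.mem_image.2 ⟨fun i => f i.castSucc, ?_, ?_⟩⟩
      · rw [Finset.mem_filter, mem_BF]; exact ⟨h1 _, h3 _⟩
      · rw [ih]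
        exact ⟨fun i => h1 _, fun i k h => h2 _ _ (by simpa using h), fun i => h2 _ _ (Fin.le_last _)⟩
      · exact Fin.snoc_init_self f

theorem count_eq {p q N j : ℕ} (hN : p + q = N) (hγ : inB N (gammaPQ p q)) (hg : Fx N (gammaPQ p q) = ⊥) :
    (({f : Fin j → Set (Set ℤ) | (∀ i, f i ∈ NCB p q) ∧
        (∀ i k : Fin j, i ≤ k → refines (f i) (f k))}.ncard : ℕ) : ℝ) = FF N (j+1) N (gammaPQ p q) := by
  classical
  rw [card_chF N j _ hγ]
  have himg : {f : Fin j → Set (Set ℤ) | (∀ i, f i ∈ NCB p q) ∧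
        (∀ i k : Fin j, i ≤ k → refines (f i) (f k))} =
      (fun σ i => omegaTilde N (σ i)) '' (chF N j (gammaPQ p q) : Set (Fin j → Equiv.Perm ℤ)) := by
    ext f
    constructor
    · rintro ⟨h1, h2⟩
      choose σ hs hf using h1
      rw [hN] at hf
      have hB : ∀ i, inB N (σ i) := fun i => hN ▸ (hs i).1
      have hL : ∀ i, LE' N (σ i) (gammaPQ p q) := fun i => by
        have := (hs i).2
        rw [hN, leB_iff (hB i) hγ] at this
        exact this
      refine ⟨σ, ?_, ?_⟩
      · rw [Finset.mem_coe, mem_chF]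
        refine ⟨hB, fun i k hik => ?_, hL⟩
        have := h2 i k hik
        rw [hf, hf, refines_iff (hB i) (hB k)] at this
        exact bw_le (hB i) (hB k) hγ hg (hL i) (hL k) this
      · ext1 i; exact (hf i).symm
    · rintro ⟨σ, hs, rfl⟩
      rw [Finset.mem_coe, mem_chF] at hs
      obtain ⟨h1, h2, h3⟩ := hs
      refine ⟨fun i => ⟨σ i, ⟨hN.symm ▸ h1 i, ?_⟩, by rw [hN]⟩, fun i k hik => ?_⟩
      · rw [hN, leB_iff (h1 i) hγ]; exact h3 i
      · rw [refines_iff (h1 i) (h1 k)]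
        exact Fx_le_of_leB (h2 i k hik)
  rw [himg, Set.ncard_image_of_injOn, Set.ncard_coe_finset]
  intro σ hs τ ht h
  rw [Finset.mem_coe, mem_chF] at hs ht
  ext1 i
  have hi : omegaTilde N (σ i) = omegaTilde N (τ i) := congrFun h i
  have hr : ∀ π : Set (Set ℤ), refines π π := fun π A hA => ⟨A, hA, subset_rfl⟩
  have a1 : Fx N (τ i) ≤ Fx N (σ i) := by
    rw [← refines_iff (hs.1 i) (ht.1 i), hi]; exact hr _
  have a2 : Fx N (σ i) ≤ Fx N (τ i) := by
    rw [← refines_iff (ht.1 i) (hs.1 i), hi]; exact hr _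
  have b1 := bw_le (hs.1 i) (ht.1 i) hγ hg (hs.2.2 i) (ht.2.2 i) a1
  have b2 := bw_le (ht.1 i) (hs.1 i) hγ hg (ht.2.2 i) (hs.2.2 i) a2
  have := eq_one_of_cod (inB_mul (inB_inv (hs.1 i)) (ht.1 i)) (by omega)
  rw [inv_mul_eq_one] at this
  exact this


structure SCyc (w : Equiv.Perm ℤ) (r : ℕ) (e : ℤ) (f : ℕ → ℤ) : Prop where
  pos : 0 < r
  sgn : e = 1 ∨ e = -1
  ne : ∀ j, j < r → f j ≠ 0
  inj : ∀ i j, i < r → j < r → |f i| = |f j| → i = j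
  step : ∀ j, j + 1 < r → w (f j) = f (j+1)
  last : ∀ j, j + 1 = r → w (f j) = e * f 0

namespace SCyc
variable {w : Equiv.Perm ℤ} {r : ℕ} {e : ℤ} {f : ℕ → ℤ} {N : ℕ}

theorem pow_apply (h : SCyc w r e f) (j : ℕ) (hj : j < r) : (w ^ j) (f 0) = f j := by
  induction j with
  | zero => simp
  | succ j ih => rw [pow_succ', Equiv.Perm.mul_apply, ih (by omega), h.step j hj]

theorem sc (h : SCyc w r e f) {i j : ℕ} (hi : i < r) (hj : j < r) : SameCycle w (f i) (f j) := by
  have h1 : ∀ j, j < r → SameCycle w (f 0) (f j) := fun j hj =>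
    ⟨(j:ℤ), by rw [zpow_natCast]; exact h.pow_apply j hj⟩
  exact (h1 i hi).symm.trans (h1 j hj)

theorem sc_last (h : SCyc w r e f) : SameCycle w (f 0) (e * f 0) := by
  obtain ⟨k, rfl⟩ : ∃ k, r = k + 1 := ⟨r - 1, by have := h.pos; omega⟩
  have := h.last k rfl
  rw [← this]
  exact (h.sc h.pos (by omega)).trans (Equiv.Perm.sameCycle_apply_right.2 (SameCycle.refl _ _))

theorem inv_set {F : Set ℤ} (h1 : ∀ z ∈ F, w z ∈ F) (h2 : ∀ z ∈ F, ∃ y ∈ F, w y = z) {x y : ℤ}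
    (h : SameCycle w x y) (hx : x ∈ F) : y ∈ F := by
  have h3 : ∀ z ∈ F, w⁻¹ z ∈ F := by
    intro z hz
    obtain ⟨y, hy, rfl⟩ := h2 z hz
    simpa using hy
  have n1 : ∀ k : ℕ, ∀ z ∈ F, (w ^ k) z ∈ F := by
    intro k; induction k with
    | zero => intro z hz; simpa using hz
    | succ k ih => intro z hz; rw [pow_succ', Equiv.Perm.mul_apply]; exact h1 _ (ih z hz)
  have n2 : ∀ k : ℕ, ∀ z ∈ F, (w⁻¹ ^ k) z ∈ F := by
    intro k; induction k with
    | zero => intro z hz; simpa using hz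
    | succ k ih => intro z hz; rw [pow_succ', Equiv.Perm.mul_apply]; exact h3 _ (ih z hz)
  obtain ⟨k, rfl⟩ := h
  cases k with
  | ofNat k => exact n1 k x hx
  | negSucc k =>
    rw [zpow_negSucc, ← inv_pow]; exact n2 _ x hx

theorem orbit (hw : inB N w) (h : SCyc w r e f) {i : ℕ} (hi : i < r) {y : ℤ} (hy : SameCycle w (f i) y) :
    ∃ k, k < r ∧ (y = f k ∨ (e = -1 ∧ y = -f k)) := by
  refine inv_set (F := {y | ∃ k, k < r ∧ (y = f k ∨ (e = -1 ∧ y = -f k))}) ?_ ?_ hy ⟨i, hi, Or.inl rfl⟩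
  · rintro z ⟨k, hk, hz⟩
    by_cases hk2 : k + 1 < r
    · refine ⟨k+1, hk2, ?_⟩
      rcases hz with rfl | ⟨he, rfl⟩
      · left; exact h.step k hk2
      · right; rw [hw.1, h.step k hk2]; exact ⟨he, rfl⟩
    · have hl := h.last k (by omega)
      refine ⟨0, h.pos, ?_⟩
      rcases h.sgn with he | he <;> rw [he] at hl <;> rcases hz with rfl | ⟨he2, rfl⟩
      · left; rw [hl]; ring
      · omega
      · right; rw [hl]; exact ⟨he, by ring⟩
      · left; rw [hw.1, hl]; ring
  · rintro z ⟨k, hk, hz⟩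
    rcases k with _ | k
    · have hl := h.last (r-1) (by omega)
      rcases h.sgn with he | he <;> rw [he] at hl <;> rcases hz with rfl | ⟨he2, rfl⟩
      · exact ⟨f (r-1), ⟨r-1, by omega, Or.inl rfl⟩, by rw [hl]; ring⟩
      · omega
      · exact ⟨-f (r-1), ⟨r-1, by omega, Or.inr ⟨he, rfl⟩⟩, by rw [hw.1, hl]; ring⟩
      · exact ⟨f (r-1), ⟨r-1, by omega, Or.inl rfl⟩, by rw [hl]; ring⟩
    · have hl := h.step k hk
      rcases hz with rfl | ⟨he2, rfl⟩
      · exact ⟨f k, ⟨k, by omega, Or.inl rfl⟩, hl⟩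
      · exact ⟨-f k, ⟨k, by omega, Or.inr ⟨he2, rfl⟩⟩, by rw [hw.1, hl]⟩

theorem bal_iff (hw : inB N w) (h : SCyc w r e f) {i : ℕ} (hi : i < r) : bal w (f i) ↔ e = -1 := by
  constructor
  · intro hb
    obtain ⟨k, hk, h1 | h1⟩ := h.orbit hw hi hb
    · have := h.inj i k hi hk (by rw [← h1, abs_neg])
      subst this
      have := h.ne i hi
      omega
    · exact h1.1
  · rintro rfl
    have h0 : bal w (f 0) := by
      have := h.sc_last
      rw [neg_one_mul] at this; exact this
    exact bal_of_sc hw (h.sc h.pos hi) h0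

theorem sc_neg' (hw : inB N w) (h : SCyc w r (-1) f) {i j : ℕ} (hi : i < r) (hj : j < r) :
    SameCycle w (f i) (-f j) := (h.sc hi hj).trans ((h.bal_iff hw hj).2 rfl)

end SCyc

noncomputable def absf (w : Equiv.Perm ℤ) (x : ℤ) : ℤ := |w x|
noncomputable def hr (w : Equiv.Perm ℤ) (x : ℤ) : ℕ := Function.minimalPeriod (absf w) |x|

theorem absf_abs {N : ℕ} {w : Equiv.Perm ℤ} (hw : inB N w) (x : ℤ) : absf w |x| = |w x| := by
  unfold absf
  rcases abs_choice x with h | h <;> rw [h]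
  rw [hw.1, abs_neg]

theorem absf_iter {N : ℕ} {w : Equiv.Perm ℤ} (hw : inB N w) (x : ℤ) (k : ℕ) : (absf w)^[k] |x| = |(w ^ k) x| := by
  induction k with
  | zero => simp
  | succ k ih => rw [Function.iterate_succ_apply', ih, absf_abs hw, pow_succ', Equiv.Perm.mul_apply]

theorem SCyc.hr_eq {N : ℕ} {w : Equiv.Perm ℤ} {r : ℕ} {e : ℤ} {f : ℕ → ℤ} (hw : inB N w) (h : SCyc w r e f)
    {i : ℕ} (hi : i < r) : hr w (f i) = r := by
  have hit : ∀ k, k < r → (absf w)^[k] |f 0| = |f k| := fun k hk => by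
    rw [absf_iter hw, h.pow_apply k hk]
  have hper : (absf w)^[r] |f 0| = |f 0| := by
    obtain ⟨k, rfl⟩ : ∃ k, r = k + 1 := ⟨r - 1, by omega⟩
    rw [Function.iterate_succ_apply', hit k (by omega), absf_abs hw, h.last k rfl, abs_mul]
    rcases h.sgn with he | he <;> rw [he] <;> simp
  have hp : Function.IsPeriodicPt (absf w) r |f 0| := hper
  have h0 : Function.minimalPeriod (absf w) |f 0| = r := by
    have h1 := hp.minimalPeriod_pos h.pos
    have h2 := hp.minimalPeriod_le h.pos
    by_contra hne
    have h3 := Function.iterate_minimalPeriod (f := absf w) (x := |f 0|)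
    rw [hit _ (by omega)] at h3
    have := h.inj _ 0 (by omega) h.pos h3
    omega
  unfold hr
  rw [← hit i hi, Function.minimalPeriod_apply_iterate (Function.mk_mem_periodicPts h.pos hp), h0]

theorem exists_pow {N : ℕ} {w : Equiv.Perm ℤ} (hw : inB N w) : ∃ k, 0 < k ∧ w ^ k = 1 := by
  have hpow : ∀ k : ℕ, inB N (w ^ k) := by
    intro k; induction k with
    | zero => exact inB_one N
    | succ k ih => rw [pow_succ]; exact inB_mul ih hw
  have : ¬ Function.Injective (fun k : ℕ => w ^ k) := by
    intro hi
    exact Set.infinite_of_injective_forall_mem hi hpow (finite_inB N)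
  unfold Function.Injective at this
  push Not at this
  obtain ⟨a, b, hab, hne⟩ := this
  rcases lt_or_gt_of_ne hne with h | h
  · refine ⟨b - a, by omega, ?_⟩
    have := pow_sub_mul_pow w h.le
    rw [← hab] at this
    exact mul_eq_right.1 this
  · refine ⟨a - b, by omega, ?_⟩
    have := pow_sub_mul_pow w h.le
    rw [hab] at this
    exact mul_eq_right.1 this

theorem exists_SCyc {N : ℕ} {w : Equiv.Perm ℤ} (hw : inB N w) {x : ℤ} (hx : x ≠ 0) :
    ∃ r e, SCyc w r e (fun j => (w ^ j) x) := by
  obtain ⟨k, hk, hk1⟩ := exists_pow hw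
  have hp : Function.IsPeriodicPt (absf w) k |x| := by
    unfold Function.IsPeriodicPt Function.IsFixedPt
    rw [absf_iter hw, hk1]; rfl
  have hpow0 : ∀ k : ℕ, (w ^ k) 0 = 0 := by
    intro k; induction k with
    | zero => rfl
    | succ k ih => rw [pow_succ', Equiv.Perm.mul_apply, ih]; apply hw.2; simp [signedSet]
  have hr : |(w ^ (Function.minimalPeriod (absf w) |x|)) x| = |x| := by
    rw [← absf_iter hw]; exact Function.iterate_minimalPeriod
  obtain ⟨e, he, he2⟩ : ∃ e : ℤ, (e = 1 ∨ e = -1) ∧ (w ^ (Function.minimalPeriod (absf w) |x|)) x = e * x := by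
    rcases abs_eq_abs.1 hr with h | h
    · exact ⟨1, Or.inl rfl, by rw [h]; ring⟩
    · exact ⟨-1, Or.inr rfl, by rw [h]; ring⟩
  refine ⟨Function.minimalPeriod (absf w) |x|, e, hp.minimalPeriod_pos hk, he, ?_, ?_, ?_, ?_⟩
  · intro j _ h
    rw [← hpow0 j] at h
    exact hx ((w ^ j).injective h)
  · intro i j hi hj h
    rw [← absf_iter hw, ← absf_iter hw] at h
    exact Function.iterate_injOn_Iio_minimalPeriod hi hj h
  · intro j _
    rw [pow_succ', Equiv.Perm.mul_apply]
  · intro j hj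
    rw [pow_zero, Equiv.Perm.one_apply, ← he2, ← hj, pow_succ', Equiv.Perm.mul_apply]


noncomputable def Wt (m : ℕ) (e : ℤ) (r : ℕ) : ℝ := if e = -1 then Bv m r else Av m r

theorem Wt_nonneg {m : ℕ} (hm : 1 ≤ m) (e : ℤ) (r : ℕ) : 0 ≤ Wt m e r := by
  unfold Wt; split_ifs
  · exact Bv_nonneg m hm r
  · exact Av_nonneg m hm r

open Classical in
noncomputable def gw (m : ℕ) (w : Equiv.Perm ℤ) (x : ℤ) : ℝ :=
  (if bal w x then Bv m (hr w x) else Av m (hr w x)) ^ ((hr w x : ℝ)⁻¹)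

def TT (r : ℕ) (f : ℕ → ℤ) : Finset ℤ := (Finset.range r).image (fun j => |f j|)

theorem mem_TT {r : ℕ} {f : ℕ → ℤ} {x : ℤ} : x ∈ TT r f ↔ ∃ j, j < r ∧ |f j| = x := by
  simp [TT]

noncomputable def Rw (m N : ℕ) (w : Equiv.Perm ℤ) (r : ℕ) (f : ℕ → ℤ) : ℝ :=
  ∏ x ∈ Finset.Icc (1:ℤ) N \ TT r f, gw m w x

noncomputable def val (m N : ℕ) (w : Equiv.Perm ℤ) : ℝ := ∏ x ∈ Finset.Icc (1:ℤ) N, gw m w x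

theorem gw_abs (m : ℕ) (w : Equiv.Perm ℤ) (x : ℤ) : gw m w |x| = gw m w x := by
  have h1 : hr w |x| = hr w x := by unfold hr; rw [abs_abs]
  have h2 : bal w |x| ↔ bal w x := by
    rcases abs_choice x with h | h <;> rw [h]
    exact bal_neg
  unfold gw
  rw [h1]
  by_cases h : bal w x
  · rw [if_pos h, if_pos (h2.2 h)]
  · rw [if_neg h, if_neg (mt h2.1 h)]

namespace SCyc
variable {w w' : Equiv.Perm ℤ} {r : ℕ} {e : ℤ} {f : ℕ → ℤ} {N m : ℕ}

theorem gw_eq (hw : inB N w) (h : SCyc w r e f) {i : ℕ} (hi : i < r) (m : ℕ) :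
    gw m w (f i) = (Wt m e r) ^ ((r : ℝ)⁻¹) := by
  unfold gw Wt
  rw [h.hr_eq hw hi]
  have := h.bal_iff hw hi
  by_cases he : e = -1
  · rw [if_pos he, if_pos (this.2 he)]
  · rw [if_neg he, if_neg (mt this.1 he)]

theorem prod_TT (hw : inB N w) (h : SCyc w r e f) (hm : 1 ≤ m) :
    ∏ x ∈ TT r f, gw m w x = Wt m e r := by
  unfold TT
  rw [Finset.prod_image]
  · rw [Finset.prod_congr rfl (g := fun _ => (Wt m e r) ^ ((r : ℝ)⁻¹)), Finset.prod_const, Finset.card_range,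
      Real.rpow_inv_natCast_pow (Wt_nonneg hm e r) (by have := h.pos; omega)]
    intro j hj
    rw [gw_abs, h.gw_eq hw (Finset.mem_range.1 hj)]
  · intro i hi j hj hij
    exact h.inj i j (by simpa using hi) (by simpa using hj) hij

theorem mem_ss (hw : inB N w) (h : SCyc w r e f) {i j : ℕ} (hi : i < r) (hj : j < r) (hs : f i ∈ signedSet N) :
    f j ∈ signedSet N := (sc_mem hw (h.sc hi hj)).2 hs

theorem abs_Icc {x : ℤ} (h : x ∈ signedSet N) : |x| ∈ Finset.Icc (1:ℤ) N := by
  rw [ss_iff] at h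
  rw [Finset.mem_Icc, abs_le]
  refine ⟨?_, by omega, by omega⟩
  have := abs_pos.2 h.1
  omega

theorem TT_sub (hw : inB N w) (h : SCyc w r e f) {i : ℕ} (hi : i < r) (hs : f i ∈ signedSet N) :
    TT r f ⊆ Finset.Icc (1:ℤ) N := by
  intro x hx
  obtain ⟨j, hj, rfl⟩ := mem_TT.1 hx
  exact abs_Icc (h.mem_ss hw hi hj hs)

theorem val_eq (hw : inB N w) (h : SCyc w r e f) {i : ℕ} (hi : i < r) (hs : f i ∈ signedSet N) (hm : 1 ≤ m) :
    val m N w = Wt m e r * Rw m N w r f := by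
  unfold val Rw
  rw [← h.prod_TT hw hm, mul_comm, Finset.prod_sdiff (h.TT_sub hw hi hs)]

theorem TT_inv (hw : inB N w) (h : SCyc w r e f) {z : ℤ} (hz : |w z| ∈ TT r f) : |z| ∈ TT r f := by
  obtain ⟨k, hk, hkz⟩ := mem_TT.1 hz
  have hh : ∀ y, |w y| = |w z| → |y| = |z| := by
    intro y hy
    rcases abs_eq_abs.1 hy with h | h
    · rw [w.injective h]
    · rw [← hw.1] at h; rw [w.injective h, abs_neg]
  rw [mem_TT]
  rcases k with _ | k
  · refine ⟨r-1, by omega, hh _ ?_⟩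
    rw [h.last (r-1) (by omega), abs_mul, ← hkz]
    rcases h.sgn with he | he <;> rw [he] <;> simp
  · exact ⟨k, by omega, hh _ (by rw [h.step k hk, hkz])⟩

theorem common (hw : inB N w) (h : SCyc w r e f) (hag : ∀ z, |z| ∉ TT r f → w' z = w z) {x : ℤ} (hx : x ≠ 0)
    (hxT : |x| ∉ TT r f) : ∃ r' e' g, SCyc w r' e' g ∧ SCyc w' r' e' g ∧ g 0 = x ∧ ∀ j, |g j| ∉ TT r f := by
  obtain ⟨r', e', hg⟩ := exists_SCyc hw hx
  have hT : ∀ j : ℕ, |(w ^ j) x| ∉ TT r f := by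
    intro j; induction j with
    | zero => simpa using hxT
    | succ j ih =>
      rw [pow_succ', Equiv.Perm.mul_apply]
      exact fun h2 => ih (h.TT_inv hw h2)
  refine ⟨r', e', _, hg, ⟨hg.pos, hg.sgn, hg.ne, hg.inj, fun j hj => ?_, fun j hj => ?_⟩, by simp, hT⟩
  · rw [hag _ (hT j)]; exact hg.step j hj
  · rw [hag _ (hT j)]; exact hg.last j hj

theorem gw_congr (hw : inB N w) (hw' : inB N w') (h : SCyc w r e f) (hag : ∀ z, |z| ∉ TT r f → w' z = w z) {x : ℤ} (hx : x ≠ 0)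
    (hxT : |x| ∉ TT r f) : gw m w' x = gw m w x := by
  obtain ⟨r', e', g, h1, h2, rfl, _⟩ := h.common hw hag hx hxT
  rw [h1.gw_eq hw h1.pos, h2.gw_eq hw' h1.pos]

end SCyc

/-- at most one balanced orbit -/
def UB (w : Equiv.Perm ℤ) : Prop := ∀ x y, x ≠ 0 → y ≠ 0 → bal w x → bal w y → SameCycle w x y


theorem rf_neg {n a : ℤ} (hn : n ≠ 0) (ha : a ≠ 0) (z : ℤ) : rf n a (-z) = -rf n a z := by
  rw [rf_apply hn ha, rf_apply hn ha]; split_ifs <;> omega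

theorem rf_off {n a z : ℤ} (hn : n ≠ 0) (ha : a ≠ 0) (h1 : |z| ≠ |n|) (h2 : |z| ≠ |a|) : rf n a z = z := by
  rw [rf_apply hn ha]
  have e1 : z ≠ n := fun h => h1 (by rw [h])
  have e2 : z ≠ a := fun h => h2 (by rw [h])
  have e3 : z ≠ -n := fun h => h1 (by rw [h, abs_neg])
  have e4 : z ≠ -a := fun h => h2 (by rw [h, abs_neg])
  simp [e1, e2, e3, e4]

theorem sgn_abs {e : ℤ} (he : e = 1 ∨ e = -1) (x : ℤ) : |e * x| = |x| := by
  rcases he with rfl | rfl <;> simp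

theorem sgn_map {e : ℤ} (he : e = 1 ∨ e = -1) {w : Equiv.Perm ℤ} (hw : ∀ x, w (-x) = -w x) (x : ℤ) :
    w (e * x) = e * w x := by
  rcases he with rfl | rfl <;> simp [hw]

theorem sgn_mul {e : ℤ} (he : e = 1 ∨ e = -1) : e * e = 1 := by
  rcases he with rfl | rfl <;> simp

namespace SCyc
variable {w w' : Equiv.Perm ℤ} {r : ℕ} {e s n : ℤ} {d : ℕ → ℤ} {N m i : ℕ}

theorem n_ne (h : SCyc w r e d) (hn : d (r-1) = e * n) : n ≠ 0 := by
  rintro rfl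
  exact h.ne (r-1) (by have := h.pos; omega) (by rw [hn, mul_zero])

theorem w_n (hw : inB N w) (h : SCyc w r e d) (hn : d (r-1) = e * n) : w n = d 0 := by
  have h1 := h.last (r-1) (by have := h.pos; omega)
  rw [hn, sgn_map h.sgn hw.1] at h1
  rcases h.sgn with he | he <;> rw [he] at h1 <;> omega

theorem split1 (hw : inB N w) (h : SCyc w r e d) (hn : d (r-1) = e * n) (hs : s = 1 ∨ s = -1) (hi : 0 < i)
    (hir : i < r) : SCyc (w * rf n (s * d (i-1))) i s d := by
  have hn0 := h.n_ne hn
  have hd0 := h.ne (i-1) (by omega)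
  have ha0 : s * d (i-1) ≠ 0 := by rcases hs with rfl | rfl <;> simpa using hd0
  have hnabs : |d (r-1)| = |n| := by rw [hn, sgn_abs h.sgn]
  refine ⟨hi, hs, fun j hj => h.ne j (by omega), fun a b ha hb => h.inj a b (by omega) (by omega), fun j hj => ?_, fun j hj => ?_⟩
  · rw [Equiv.Perm.mul_apply, rf_off hn0 ha0, h.step j (by omega)]
    · rw [← hnabs]; intro h2
      have := h.inj _ _ (by omega) (by omega) h2; omega
    · rw [sgn_abs hs]; intro h2
      have := h.inj _ _ (by omega) (by omega) h2; omega
  · have hj2 : j = i - 1 := by omega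
    rw [Equiv.Perm.mul_apply, ← h.w_n hw hn, ← sgn_map hs hw.1]
    congr 1
    have : d j = s * (s * d (i-1)) := by rw [← mul_assoc, sgn_mul hs, hj2, one_mul]
    rw [this, sgn_map hs (rf_neg hn0 ha0), rf_right hn0 ha0]

theorem split2 (hw : inB N w) (h : SCyc w r e d) (hn : d (r-1) = e * n) (hs : s = 1 ∨ s = -1) (hi : 0 < i)
    (hir : i < r) : SCyc (w * rf n (s * d (i-1))) (r - i) (e * s) (fun j => d (i + j)) := by
  have hn0 := h.n_ne hn
  have hd0 := h.ne (i-1) (by omega)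
  have ha0 : s * d (i-1) ≠ 0 := by rcases hs with rfl | rfl <;> simpa using hd0
  have hnabs : |d (r-1)| = |n| := by rw [hn, sgn_abs h.sgn]
  refine ⟨by omega, ?_, fun j hj => h.ne _ (by omega), fun a b ha hb hab => ?_, fun j hj => ?_, fun j hj => ?_⟩
  · rcases hs with rfl | rfl <;> rcases h.sgn with rfl | rfl <;> simp
  · have := h.inj (i+a) (i+b) (by omega) (by omega) hab; omega
  · rw [Equiv.Perm.mul_apply, rf_off hn0 ha0, h.step (i+j) (by omega), add_assoc]
    · rw [← hnabs]; intro h2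
      have := h.inj _ _ (by omega) (by omega) h2; omega
    · rw [sgn_abs hs]; intro h2
      have := h.inj _ _ (by omega) (by omega) h2; omega
  · have hj2 : i + j = r - 1 := by omega
    have h3 := h.step (i-1) (by omega)
    rw [hj2, hn, Equiv.Perm.mul_apply, sgn_map h.sgn (rf_neg hn0 ha0), rf_left hn0 ha0, sgn_map h.sgn hw.1,
      sgn_map hs hw.1, h3, mul_assoc]
    congr 3; omega

theorem split0 (hw : inB N w) (h : SCyc w r e d) (hn : d (r-1) = e * n) :
    SCyc (w * rf n (-n)) r (-e) d := by
  have hn0 := h.n_ne hn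
  have ha0 : -n ≠ 0 := by omega
  have hnabs : |d (r-1)| = |n| := by rw [hn, sgn_abs h.sgn]
  refine ⟨h.pos, by rcases h.sgn with rfl | rfl <;> simp, h.ne, h.inj, fun j hj => ?_, fun j hj => ?_⟩
  · have : |d j| ≠ |n| := by
      rw [← hnabs]; intro h2
      have := h.inj _ _ (by omega) (by omega) h2; omega
    rw [Equiv.Perm.mul_apply, rf_off hn0 ha0 this (by rwa [abs_neg]), h.step j (by omega)]
  · have hj2 : j = r - 1 := by omega
    rw [hj2, hn, Equiv.Perm.mul_apply, sgn_map h.sgn (rf_neg hn0 ha0), rf_left hn0 ha0, sgn_map h.sgn hw.1,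
      hw.1, h.w_n hw hn]
    ring

theorem agree (h : SCyc w r e d) (hn : d (r-1) = e * n) {a : ℤ} (ha : |a| ∈ TT r d) :
    ∀ z, |z| ∉ TT r d → (w * rf n a) z = w z := by
  intro z hz
  have hn0 := h.n_ne hn
  have ha0 : a ≠ 0 := by
    rintro rfl
    obtain ⟨j, hj, hj2⟩ := mem_TT.1 ha
    rw [abs_zero, abs_eq_zero] at hj2
    exact h.ne j hj hj2
  rw [Equiv.Perm.mul_apply, rf_off hn0 ha0]
  · intro h2
    apply hz
    rw [h2, mem_TT]
    exact ⟨r-1, by have := h.pos; omega, by rw [hn, sgn_abs h.sgn]⟩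
  · intro h2; rw [h2] at hz; exact hz ha

theorem scT (hw : inB N w) (h : SCyc w r (-1) d) {x y : ℤ} (hx : |x| ∈ TT r d) (hy : |y| ∈ TT r d) : SameCycle w x y := by
  obtain ⟨j, hj, hjx⟩ := mem_TT.1 hx
  obtain ⟨k, hk, hky⟩ := mem_TT.1 hy
  have key : ∀ {x j}, j < r → |d j| = |x| → SameCycle w (d 0) x := by
    intro x j hj hjx
    rcases abs_eq_abs.1 hjx with h1 | h1
    · rw [← h1]; exact h.sc h.pos hj
    · have : x = -d j := by omega
      rw [this]; exact h.sc_neg' hw h.pos hj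
  exact (key hj hjx).symm.trans (key hk hky)

theorem balT (hw : inB N w) (h : SCyc w r e d) {x : ℤ} (hx : |x| ∈ TT r d) : bal w x ↔ e = -1 := by
  obtain ⟨j, hj, hjx⟩ := mem_TT.1 hx
  rw [← h.bal_iff hw hj]
  rcases abs_eq_abs.1 hjx with h1 | h1
  · rw [h1]
  · rw [h1, bal_neg]

theorem orbT (hw : inB N w) (h : SCyc w r e d) {x y : ℤ} (hx : |x| ∈ TT r d) (hxy : SameCycle w x y) : |y| ∈ TT r d := by
  obtain ⟨j, hj, hjx⟩ := mem_TT.1 hx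
  have key : ∀ y, SameCycle w (d j) y → |y| ∈ TT r d := by
    intro y hy
    obtain ⟨k, hk, h1 | h1⟩ := h.orbit hw hj hy
    · rw [mem_TT]; exact ⟨k, hk, by rw [h1]⟩
    · rw [mem_TT]; exact ⟨k, hk, by rw [h1.2, abs_neg]⟩
  rcases abs_eq_abs.1 hjx with h1 | h1
  · rw [← h1] at hxy; exact key y hxy
  · have := sc_neg hw hxy
    rw [← h1] at this
    have := key _ this
    rwa [abs_neg] at this

theorem TT_split (hir : i ≤ r) (x : ℤ) : x ∈ TT r d ↔ x ∈ TT i d ∨ x ∈ TT (r - i) (fun j => d (i + j)) := by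
  simp only [mem_TT]
  constructor
  · rintro ⟨j, hj, hx⟩
    by_cases hji : j < i
    · exact Or.inl ⟨j, hji, hx⟩
    · exact Or.inr ⟨j - i, by omega, by rw [show i + (j - i) = j by omega]; exact hx⟩
  · rintro (⟨j, hj, hx⟩ | ⟨j, hj, hx⟩)
    · exact ⟨j, by omega, hx⟩
    · exact ⟨i+j, by omega, hx⟩

theorem TT_disj (h : SCyc w r e d) (hir : i ≤ r) {x : ℤ} (h1 : x ∈ TT i d) (h2 : x ∈ TT (r - i) (fun j => d (i + j))) : False := by
  rw [mem_TT] at h1 h2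
  obtain ⟨j, hj, hx⟩ := h1
  obtain ⟨k, hk, hx2⟩ := h2
  have := h.inj j (i+k) (by omega) (by omega) (by rw [hx, hx2])
  omega

theorem off_bal (hw : inB N w) (hw' : inB N w') (h : SCyc w r e d) (hag : ∀ z, |z| ∉ TT r d → w' z = w z) {x : ℤ} (hx : x ≠ 0)
    (hxT : |x| ∉ TT r d) (hb : bal w' x) : bal w x := by
  obtain ⟨r', e', g, h1, h2, rfl, _⟩ := h.common hw hag hx hxT
  rw [h1.bal_iff hw h1.pos]
  rwa [h2.bal_iff hw' h1.pos] at hb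

theorem off_sc (hw : inB N w) (hw' : inB N w') (h : SCyc w r e d) (hag : ∀ z, |z| ∉ TT r d → w' z = w z) {x y : ℤ} (hx : x ≠ 0)
    (hxT : |x| ∉ TT r d) (hb : bal w' x) (hxy : SameCycle w x y) : SameCycle w' x y := by
  obtain ⟨r', e', g, h1, h2, rfl, _⟩ := h.common hw hag hx hxT
  rw [h2.bal_iff hw' h1.pos] at hb
  subst hb
  have h0 : |g 0| ∈ TT r' g := mem_TT.2 ⟨0, h1.pos, rfl⟩
  exact h2.scT hw' h0 (h1.orbT hw h0 hxy)

theorem UB_plus (hw : inB N w) (hw' : inB N w') (h : SCyc w r e d) (hag : ∀ z, |z| ∉ TT r d → w' z = w z)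
    (hub : UB w) (hT : ∀ x, |x| ∈ TT r d → ¬ bal w' x) : UB w' := by
  intro x y hx hy bx bY
  have hx2 : |x| ∉ TT r d := fun h2 => hT x h2 bx
  have hy2 : |y| ∉ TT r d := fun h2 => hT y h2 bY
  exact h.off_sc hw hw' hag hx hx2 bx (hub x y hx hy (h.off_bal hw hw' hag hx hx2 bx) (h.off_bal hw hw' hag hy hy2 bY))

theorem UB_minus (hw : inB N w) (hw' : inB N w') (h : SCyc w r (-1) d) (hag : ∀ z, |z| ∉ TT r d → w' z = w z)
    (hub : UB w) {r' : ℕ} {g : ℕ → ℤ} (h' : SCyc w' r' (-1) g) (hT : ∀ x, |x| ∈ TT r d → bal w' x → |x| ∈ TT r' g) : UB w' := by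
  have key : ∀ x, x ≠ 0 → bal w' x → |x| ∈ TT r' g := by
    intro x hx bx
    by_cases hx2 : |x| ∈ TT r d
    · exact hT x hx2 bx
    · exfalso
      have := hub (d 0) x (h.ne 0 h.pos) hx ((h.bal_iff hw h.pos).2 rfl) (h.off_bal hw hw' hag hx hx2 bx)
      exact hx2 (h.orbT hw (mem_TT.2 ⟨0, h.pos, rfl⟩) this)
  intro x y hx hy bx bY
  exact h'.scT hw' (key x hx bx) (key y hy bY)

theorem Rw_split (hw : inB N w) (h : SCyc w r e d) (hir : i ≤ r) (hd : ∀ j, j < r → d j ∈ signedSet N)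
    (hw' : inB N w') (hag : ∀ z, |z| ∉ TT r d → w' z = w z) {s : ℤ} (h1 : SCyc w' i s d) (hm : 1 ≤ m) :
    Rw m N w' (r - i) (fun j => d (i + j)) = Wt m s i * Rw m N w r d := by
  classical
  rw [← h1.prod_TT hw' hm]
  unfold Rw
  have e1 : Finset.Icc (1:ℤ) N \ TT (r-i) (fun j => d (i+j)) = TT i d ∪ (Finset.Icc (1:ℤ) N \ TT r d) := by
    ext x
    rw [Finset.mem_union, Finset.mem_sdiff, Finset.mem_sdiff, TT_split hir x]
    constructor
    · rintro ⟨a, b⟩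
      by_cases c : x ∈ TT i d
      · exact Or.inl c
      · exact Or.inr ⟨a, fun h => h.elim c b⟩
    · rintro (a | ⟨a, b⟩)
      · refine ⟨?_, fun hb => h.TT_disj hir a hb⟩
        obtain ⟨j, hj, rfl⟩ := mem_TT.1 a
        exact abs_Icc (hd j (by omega))
      · exact ⟨a, fun c => b (Or.inr c)⟩
  rw [e1, Finset.prod_union]
  · congr 1
    refine Finset.prod_congr rfl fun x hx => ?_
    rw [Finset.mem_sdiff, Finset.mem_Icc] at hx
    exact h.gw_congr hw hw' hag (by omega) (by rw [abs_of_nonneg (by omega)]; exact hx.2)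
  · rw [Finset.disjoint_left]
    intro x hx hx2
    exact (Finset.mem_sdiff.1 hx2).2 ((TT_split hir x).2 (Or.inl hx))

theorem Rw_same (hw : inB N w) (h : SCyc w r e d) 
    (hw' : inB N w') (hag : ∀ z, |z| ∉ TT r d → w' z = w z) :
    Rw m N w' r d = Rw m N w r d := by
  unfold Rw
  refine Finset.prod_congr rfl fun x hx => ?_
  rw [Finset.mem_sdiff, Finset.mem_Icc] at hx
  exact h.gw_congr hw hw' hag (by omega) (by rw [abs_of_nonneg (by omega)]; exact hx.2)

end SCyc

theorem rel_of_dec {N : ℕ} {w : Equiv.Perm ℤ} (hw : inB N w) {n a : ℤ} (hn : n ∈ signedSet N) (ha : a ∈ signedSet N)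
    (h : cod N (w * rf n a) + 1 = cod N w) : rel w n a := by
  have hn0 := (ss_iff.1 hn).1
  have ha0 := (ss_iff.1 ha).1
  rw [rel_iff hw hn ha]
  intro v hv
  rw [← mem_Fx_rf hn0 ha0 hv.1]
  have h1 := cod_rf (N := N) hn0 ha0
  have h2 := cod_mul N (w * rf n a) (rf n a)
  rw [mul_assoc, rf_mul_self hn0 ha0, mul_one] at h2
  have : Fx N w⁻¹ ≤ Fx N (rf n a) := by
    apply Fx_le_of_leB
    rw [show (rf n a)⁻¹ * w⁻¹ = (w * rf n a)⁻¹ by rw [mul_inv_rev], cod_inv, cod_inv]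
    omega
  rw [Fx_inv] at this
  exact this hv

theorem dec_of {N : ℕ} {w : Equiv.Perm ℤ} (hw : inB N w) {n a : ℤ} (hn : n ∈ signedSet N) (ha : a ∈ signedSet N)
    (h : rel w n a) {v : ℤ → ℚ} (hv : v ∈ Fx N (w * rf n a)) (hv2 : v ∉ Fx N w) : cod N (w * rf n a) + 1 = cod N w := by
  have hn0 := (ss_iff.1 hn).1
  have ha0 := (ss_iff.1 ha).1
  rw [rel_iff hw hn ha] at h
  have h1 : Fx N w ≤ Fx N (w * rf n a) := fun u hu => Fx_inf_le _ _ _ ⟨hu, (mem_Fx_rf hn0 ha0 hu.1).2 (h u hu)⟩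
  have h2 := cod_lt_of_lt (lt_of_le_of_ne h1 (fun h3 => hv2 (h3 ▸ hv)))
  have h3 := cod_mul_rf_ge (N := N) w hn0 ha0
  omega

theorem dec_of_bal {N : ℕ} {w : Equiv.Perm ℤ} (hw : inB N w) {n a : ℤ} (hn : n ∈ signedSet N) (ha : a ∈ signedSet N)
    (h : rel w n a) {x : ℤ} (hx : x ∈ signedSet N) (h1 : bal w x) (h2 : ¬ bal (w * rf n a) x) :
    cod N (w * rf n a) + 1 = cod N w := by
  refine dec_of hw hn ha h (ovec_mem (inB_mul hw (rf_inB hn ha)) hx) fun h3 => ?_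
  have := Fx_bal h3 h1
  rw [ovec_self h2] at this
  exact one_ne_zero this


theorem conv_ps (A F : PowerSeries ℝ) (q : ℕ) : PowerSeries.coeff q (A * F) =
    PowerSeries.coeff 0 A * PowerSeries.coeff q F +
      ∑ i ∈ Finset.range q, PowerSeries.coeff (i+1) A * PowerSeries.coeff (q - 1 - i) F := by
  rw [PowerSeries.coeff_mul, Finset.Nat.sum_antidiagonal_eq_sum_range_succ
    (fun a b => PowerSeries.coeff a A * PowerSeries.coeff b F), Finset.sum_range_succ', add_comm]
  congr 1
  refine Finset.sum_congr rfl fun i _ => ?_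
  rw [show q - (i+1) = q - 1 - i by omega]

noncomputable def Cf (m : ℕ) (e : ℤ) (r k : ℕ) : ℝ :=
  if e = -1 then (k : ℝ) * PowerSeries.coeff (r-1) (GG m ^ (k-1) * BB m) else PowerSeries.coeff (r-1) (GG m ^ k)

theorem sum_e1 {S : Finset ℤ} {q : ℕ} {d : ℕ → ℤ} (φ : ℤ → ℝ) (hinj : ∀ i j, i < q → j < q → d i = d j → i = j)
    (hS : ∀ i, i < q → d i ∈ S) (h0 : ∀ a ∈ S, (∀ i, i < q → a ≠ d i) → φ a = 0) :
    ∑ a ∈ S, φ a = ∑ i ∈ Finset.range q, φ (d i) := by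
  classical
  rw [← Finset.sum_image (f := φ) (g := d)]
  · symm
    apply Finset.sum_subset
    · intro a ha
      obtain ⟨i, hi, rfl⟩ := Finset.mem_image.1 ha
      exact hS i (by simpa using hi)
    · intro a ha h
      refine h0 a ha fun i hi hai => h (Finset.mem_image.2 ⟨i, by simpa using hi, hai.symm⟩)
  · intro i hi j hj hij
    exact hinj i j (by simpa using hi) (by simpa using hj) hij

theorem sum_e2 {S : Finset ℤ} {q : ℕ} {d : ℕ → ℤ} {n : ℤ} (φ : ℤ → ℝ)
    (hinj : ∀ i j, i < q → j < q → |d i| = |d j| → i = j) (hne : ∀ i, i < q → d i ≠ 0) (hn : ∀ i, i < q → |d i| ≠ |n|)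
    (hS : ∀ i, i < q → d i ∈ S) (hS2 : ∀ i, i < q → -d i ∈ S) (hS3 : -n ∈ S)
    (h0 : ∀ a ∈ S, (∀ i, i < q → a ≠ d i) → (∀ i, i < q → a ≠ -d i) → a ≠ -n → φ a = 0) :
    ∑ a ∈ S, φ a = φ (-n) + (∑ i ∈ Finset.range q, φ (d i) + ∑ i ∈ Finset.range q, φ (-d i)) := by
  classical
  rw [← Finset.sum_image (f := φ) (g := d), ← Finset.sum_image (f := φ) (g := fun i => -d i),
    ← Finset.sum_union, ← Finset.sum_insert]
  · symm
    apply Finset.sum_subset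
    · intro a ha
      rw [Finset.mem_insert, Finset.mem_union, Finset.mem_image, Finset.mem_image] at ha
      rcases ha with rfl | ⟨i, hi, rfl⟩ | ⟨i, hi, rfl⟩
      · exact hS3
      · exact hS i (by simpa using hi)
      · exact hS2 i (by simpa using hi)
    · intro a ha h
      rw [Finset.mem_insert, Finset.mem_union, Finset.mem_image, Finset.mem_image] at h
      push Not at h
      exact h0 a ha (fun i hi hai => h.2.1 i (by simpa using hi) hai.symm)
        (fun i hi hai => h.2.2 i (by simpa using hi) hai.symm) h.1
  · intro h
    rw [Finset.mem_union, Finset.mem_image, Finset.mem_image] at h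
    rcases h with ⟨i, hi, h⟩ | ⟨i, hi, h⟩
    · exact hn i (by simpa using hi) (by rw [h, abs_neg])
    · exact hn i (by simpa using hi) (by rw [← abs_neg, h, abs_neg])
  · rw [Finset.disjoint_left]
    intro a ha hb
    rw [Finset.mem_image] at ha hb
    obtain ⟨i, hi, rfl⟩ := ha
    obtain ⟨j, hj, h⟩ := hb
    rw [Finset.mem_range] at hi hj
    have := hinj i j hi hj (by rw [← h, abs_neg])
    subst this
    have := hne i hi
    omega
  · intro i hi j hj hij
    exact hinj i j (by simpa using hi) (by simpa using hj) (by simp only [neg_inj] at hij; rw [hij])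
  · intro i hi j hj hij
    exact hinj i j (by simpa using hi) (by simpa using hj) (by rw [hij])

theorem scyc_one {w : Equiv.Perm ℤ} {x : ℤ} (hx : x ≠ 0) (h : w x = x) : SCyc w 1 1 (fun _ => x) :=
  ⟨one_pos, Or.inl rfl, fun _ _ => hx, fun i j hi hj _ => by omega, fun j hj => by omega, fun j hj => by simpa using h⟩

theorem val_one (m N : ℕ) : val m N 1 = 1 := by
  unfold val
  refine Finset.prod_eq_one fun x hx => ?_
  rw [Finset.mem_Icc] at hx
  have := (scyc_one (w := 1) (x := x) (by omega) rfl).gw_eq (inB_one N) one_pos m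
  rw [this]
  simp [Wt, Av_one]

section
variable {N m k : ℕ}

theorem PP_e1 (hm : 1 ≤ m) (hk : k + 1 ≤ N) (j : ℕ)
    (ih : ∀ w, inB (k+1) w → UB w → ∀ r e d, SCyc w r e d → d (r-1) = e * ((k+1 : ℕ) : ℤ) →
      PP N m k j w = Cf m e r j * Rw m N w r d) (w : Equiv.Perm ℤ) (hw : inB (k+1) w) (hub : UB w) (r : ℕ) (d : ℕ → ℤ)
      (h : SCyc w r 1 d) (hn : d (r-1) = 1 * ((k+1 : ℕ) : ℤ)) :
      PP N m k (j+1) w = Cf m 1 r (j+1) * Rw m N w r d := by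
  have hw2 : inB N w := inB_mono hk hw
  have hr := h.pos
  have hnS := n_mem k
  have hnN : ((k+1 : ℕ) : ℤ) ∈ signedSet N := by rw [ss_iff] at *; push_cast at *; omega
  have hdn : d (r-1) = ((k+1 : ℕ) : ℤ) := by rw [hn, one_mul]
  have hdS : ∀ i, i < r → d i ∈ signedSet (k+1) := fun i hi =>
    h.mem_ss hw (by omega : r - 1 < r) hi (by rw [hdn]; exact hnS)
  have hdN : ∀ i, i < r → d i ∈ signedSet N := fun i hi => by
    have := hdS i hi; rw [ss_iff] at *; omega
  rw [PP_succ, sum_e1 (q := r - 1) (d := d)]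
  · have e1 : Cf m 1 r (j+1) = ∑ i ∈ Finset.range (r-1), Av m (i+1) * PowerSeries.coeff (r - 1 - 1 - i) (GG m ^ j) := by
      unfold Cf
      rw [if_neg (by norm_num), pow_succ', conv_ps]
      have := Av_zero m
      unfold Av at this ⊢
      rw [this, zero_mul, zero_add]
    rw [e1, Finset.sum_mul]
    refine Finset.sum_congr rfl fun i hi => ?_
    rw [Finset.mem_range] at hi
    have hi2 : i + 1 < r := by omega
    have haN := hdN i (by omega)
    have s1 := h.split1 hw2 hn (s := 1) (i := i+1) (Or.inl rfl) (by omega) hi2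
    have s2 := h.split2 hw2 hn (s := 1) (i := i+1) (Or.inl rfl) (by omega) hi2
    simp only [Nat.add_sub_cancel, one_mul] at s1 s2
    have hag := h.agree hn (a := d i) (mem_TT.2 ⟨i, by omega, rfl⟩)
    have hw' : inB (k+1) (w * rf ((k+1 : ℕ) : ℤ) (d i)) := inB_mul hw (rf_inB hnS (hdS i (by omega)))
    have hw'N := inB_mono hk hw'
    have hnb : ∀ x, |x| ∈ TT r d → ¬ bal (w * rf ((k+1 : ℕ) : ℤ) (d i)) x := by
      intro x hx
      rcases (SCyc.TT_split hi2.le x.natAbs).1 (by rwa [Int.natCast_natAbs]) with h1 | h1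
      · rw [Int.natCast_natAbs] at h1
        rw [s1.balT hw'N h1]; norm_num
      · rw [Int.natCast_natAbs] at h1
        rw [s2.balT hw'N h1]; norm_num
    have hd0 : |d 0| ∈ TT r d := mem_TT.2 ⟨0, by omega, rfl⟩
    have hdec : cod N (w * rf ((k+1 : ℕ) : ℤ) (d i)) + 1 = cod N w := by
      refine dec_of hw2 hnN haN ?_ (ovec_mem hw'N (hdN 0 (by omega))) ?_
      · left; rw [← hdn]; exact h.sc (by omega) (by omega)
      · intro h3
        have h4 := h3.2 ((k+1 : ℕ) : ℤ)
        rw [h.w_n hw2 hn, ovec_self (hnb _ hd0)] at h4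
        have h5 := ovec_eq_one h4.symm
        have h6 := s1.orbT hw'N (mem_TT.2 ⟨0, by omega, rfl⟩) h5
        refine h.TT_disj hi2.le h6 (mem_TT.2 ⟨r - 1 - (i+1), by omega, ?_⟩)
        rw [show i + 1 + (r - 1 - (i+1)) = r - 1 by omega, hdn]
    rw [if_pos hdec, ih _ hw' (h.UB_plus hw2 hw'N hag hub hnb) _ _ _ s2 (by
      rw [show i + 1 + (r - (i + 1) - 1) = r - 1 by omega]; exact hn),
      h.Rw_split hw2 hi2.le hdN hw'N hag s1 hm]
    unfold Cf Wt
    rw [if_neg (by norm_num), if_neg (by norm_num), show r - (i+1) - 1 = r - 1 - 1 - i by omega]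
    ring
  · intro a b ha hb hab
    exact h.inj a b (by omega) (by omega) (by rw [hab])
  · intro i hi
    rw [mem_Sf]
    refine ⟨fun h2 => ?_, hdS i (by omega)⟩
    rw [← hdn] at h2
    have := h.inj i (r-1) (by omega) (by omega) (by rw [h2])
    omega
  · intro a ha hne
    rw [if_neg]
    intro hdec
    rw [mem_Sf] at ha
    have haN : a ∈ signedSet N := by have := ha.2; rw [ss_iff] at *; omega
    have hrel := rel_of_dec hw2 hnN haN hdec
    rw [← hdn] at hrel
    rcases hrel with h1 | ⟨h1, _⟩
    · obtain ⟨t, ht, h2 | h2⟩ := h.orbit hw2 (by omega : r - 1 < r) h1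
      · by_cases h3 : t = r - 1
        · rw [h3, hdn] at h2; exact ha.1 h2
        · exact hne t (by omega) h2
      · exact absurd h2.1 (by norm_num)
    · rw [h.bal_iff hw2 (by omega)] at h1
      exact absurd h1 (by norm_num)

end


theorem SCyc.neg {w : Equiv.Perm ℤ} {N r : ℕ} {e : ℤ} {d : ℕ → ℤ} (hw : inB N w) (h : SCyc w r e d) :
    SCyc w r e (fun j => -d j) :=
  ⟨h.pos, h.sgn, fun j hj => neg_ne_zero.2 (h.ne j hj), fun i j hi hj hij => h.inj i j hi hj (by simpa using hij),
    fun j hj => by simp only [hw.1, h.step j hj], fun j hj => by simp only [hw.1, h.last j hj, mul_neg]⟩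

theorem TT_neg (r : ℕ) (d : ℕ → ℤ) : TT r (fun j => -d j) = TT r d := by
  ext x; simp only [mem_TT, abs_neg]

theorem Rw_neg (m N : ℕ) (w : Equiv.Perm ℤ) (r : ℕ) (d : ℕ → ℤ) : Rw m N w r (fun j => -d j) = Rw m N w r d := by
  unfold Rw; rw [TT_neg]

section
variable {N m k : ℕ}

theorem ps_m1 (hm : 1 ≤ m) (q j : ℕ) : PowerSeries.coeff q (GG m ^ j) +
    (∑ i ∈ Finset.range q, Av m (i+1) * ((j:ℝ) * PowerSeries.coeff (q - 1 - i) (GG m ^ (j-1) * BB m)) +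
     ∑ i ∈ Finset.range q, Bv m (i+1) * PowerSeries.coeff (q - 1 - i) (GG m ^ j)) =
     ((j+1:ℕ):ℝ) * PowerSeries.coeff q (GG m ^ j * BB m) := by
  have hB0 : PowerSeries.coeff 0 (BB m) = 1 := by
    have := Bv_eq m hm 0
    unfold Bv at this
    rw [this]; simp
  have e2 : PowerSeries.coeff q (GG m ^ j * BB m) = PowerSeries.coeff q (GG m ^ j) +
      ∑ i ∈ Finset.range q, Bv m (i+1) * PowerSeries.coeff (q - 1 - i) (GG m ^ j) := by
    rw [mul_comm, conv_ps, hB0, one_mul]; rfl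
  have e1 : ∑ i ∈ Finset.range q, Av m (i+1) * ((j:ℝ) * PowerSeries.coeff (q - 1 - i) (GG m ^ (j-1) * BB m)) =
      (j:ℝ) * PowerSeries.coeff q (GG m ^ j * BB m) := by
    rcases j with _ | j
    · simp
    · have h0 := Av_zero m
      unfold Av at h0 ⊢
      rw [Nat.add_sub_cancel, pow_succ', mul_assoc, conv_ps (GG m), h0, zero_mul, zero_add, Finset.mul_sum]
      refine Finset.sum_congr rfl fun i _ => ?_
      ring
  rw [e1]
  push_cast
  rw [add_mul, one_mul, e2]
  ring

theorem PP_m1 (hm : 1 ≤ m) (hk : k + 1 ≤ N) (j : ℕ)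
    (ih : ∀ w, inB (k+1) w → UB w → ∀ r e d, SCyc w r e d → d (r-1) = e * ((k+1 : ℕ) : ℤ) →
      PP N m k j w = Cf m e r j * Rw m N w r d) (w : Equiv.Perm ℤ) (hw : inB (k+1) w) (hub : UB w) (r : ℕ) (d : ℕ → ℤ)
      (h : SCyc w r (-1) d) (hn : d (r-1) = -1 * ((k+1 : ℕ) : ℤ)) :
      PP N m k (j+1) w = Cf m (-1) r (j+1) * Rw m N w r d := by
  have hw2 : inB N w := inB_mono hk hw
  have hr := h.pos
  have hnS := n_mem k
  have hmN : ∀ {x : ℤ}, x ∈ signedSet (k+1) → x ∈ signedSet N := by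
    intro x hx; rw [ss_iff] at *; omega
  have hnN : ((k+1 : ℕ) : ℤ) ∈ signedSet N := hmN hnS
  have hdn : d (r-1) = -((k+1 : ℕ) : ℤ) := by rw [hn]; ring
  have hdS : ∀ i, i < r → d i ∈ signedSet (k+1) := fun i hi =>
    h.mem_ss hw (by omega : r - 1 < r) hi (by rw [hdn]; exact ss_neg.2 hnS)
  have hdN : ∀ i, i < r → d i ∈ signedSet N := fun i hi => hmN (hdS i hi)
  have habs : |d (r-1)| = |((k+1 : ℕ) : ℤ)| := by rw [hdn, abs_neg]
  have hnT : |((k+1 : ℕ) : ℤ)| ∈ TT r d := mem_TT.2 ⟨r-1, by omega, habs⟩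
  have hd0 : ∀ i, i < r → |d i| ∈ TT r d := fun i hi => mem_TT.2 ⟨i, hi, rfl⟩
  have hrel : ∀ a, |a| ∈ TT r d → rel w ((k+1 : ℕ) : ℤ) a := fun a ha =>
    Or.inl (h.scT hw2 hnT ha)
  rw [PP_succ, sum_e2 (q := r - 1) (d := d) (n := ((k+1 : ℕ) : ℤ))]
  · have e1 : Cf m (-1) r (j+1) = ((j+1:ℕ):ℝ) * PowerSeries.coeff (r-1) (GG m ^ j * BB m) := by
      unfold Cf
      rw [if_pos rfl, Nat.add_sub_cancel]
    rw [e1, ← ps_m1 hm, add_mul, add_mul, Finset.sum_mul, Finset.sum_mul]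
    congr 1
    · -- a = -n
      have s0 := h.split0 hw2 hn
      rw [neg_neg] at s0
      have haT : |-((k+1 : ℕ) : ℤ)| ∈ TT r d := by rw [abs_neg]; exact hnT
      have hag := h.agree hn haT
      have hw' : inB (k+1) (w * rf ((k+1 : ℕ) : ℤ) (-((k+1 : ℕ) : ℤ))) := inB_mul hw (rf_inB hnS (ss_neg.2 hnS))
      have hw'N := inB_mono hk hw'
      have hnb : ∀ x, |x| ∈ TT r d → ¬ bal (w * rf ((k+1 : ℕ) : ℤ) (-((k+1 : ℕ) : ℤ))) x := by
        intro x hx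
        rw [s0.balT hw'N hx]; norm_num
      have hdec := dec_of_bal hw2 hnN (ss_neg.2 hnN) (hrel _ haT) hnN ((h.balT hw2 hnT).2 rfl) (hnb _ hnT)
      rw [if_pos hdec, ih _ hw' (h.UB_plus hw2 hw'N hag hub hnb) _ _ _ (s0.neg hw'N) (by
        rw [hn]; ring), Rw_neg, h.Rw_same hw2 hw'N hag]
      unfold Cf
      rw [if_neg (by norm_num)]
    congr 1
    · refine Finset.sum_congr rfl fun i hi => ?_
      rw [Finset.mem_range] at hi
      have hi2 : i + 1 < r := by omega
      have haN := hdN i (by omega)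
      have s1 := h.split1 hw2 hn (s := 1) (i := i+1) (Or.inl rfl) (by omega) hi2
      have s2 := h.split2 hw2 hn (s := 1) (i := i+1) (Or.inl rfl) (by omega) hi2
      simp only [Nat.add_sub_cancel, one_mul, mul_one] at s1 s2
      have hag := h.agree hn (a := d i) (hd0 i (by omega))
      have hw' : inB (k+1) (w * rf ((k+1 : ℕ) : ℤ) (d i)) := inB_mul hw (rf_inB hnS (hdS i (by omega)))
      have hw'N := inB_mono hk hw'
      have hT : ∀ x, |x| ∈ TT r d → bal (w * rf ((k+1 : ℕ) : ℤ) (d i)) x → |x| ∈ TT (r - (i+1)) (fun j => d (i+1+j)) := by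
        intro x hx hb
        rcases (SCyc.TT_split hi2.le |x|).1 hx with h1 | h1
        · rw [s1.balT hw'N h1] at hb; norm_num at hb
        · exact h1
      have hdec : cod N (w * rf ((k+1 : ℕ) : ℤ) (d i)) + 1 = cod N w := by
        refine dec_of_bal hw2 hnN haN (hrel _ (hd0 i (by omega))) (hdN 0 hr) ((h.balT hw2 (hd0 0 hr)).2 rfl) ?_
        rw [s1.bal_iff hw'N (by omega)]; norm_num
      rw [if_pos hdec, ih _ hw' (h.UB_minus hw2 hw'N hag hub s2 hT) _ _ _ s2 (by
        rw [show i + 1 + (r - (i + 1) - 1) = r - 1 by omega]; exact hn),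
        h.Rw_split hw2 hi2.le hdN hw'N hag s1 hm]
      unfold Cf Wt
      rw [if_pos rfl, if_neg (by norm_num), show r - (i+1) - 1 = r - 1 - 1 - i by omega]
      ring
    · refine Finset.sum_congr rfl fun i hi => ?_
      rw [Finset.mem_range] at hi
      have hi2 : i + 1 < r := by omega
      have haN := ss_neg.2 (hdN i (by omega))
      have haT : |-d i| ∈ TT r d := by rw [abs_neg]; exact hd0 i (by omega)
      have s1 := h.split1 hw2 hn (s := -1) (i := i+1) (Or.inr rfl) (by omega) hi2
      have s2 := h.split2 hw2 hn (s := -1) (i := i+1) (Or.inr rfl) (by omega) hi2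
      simp only [Nat.add_sub_cancel, neg_mul, one_mul, neg_neg] at s1 s2
      have hag := h.agree hn (a := -d i) haT
      have hw' : inB (k+1) (w * rf ((k+1 : ℕ) : ℤ) (-d i)) := inB_mul hw (rf_inB hnS (ss_neg.2 (hdS i (by omega))))
      have hw'N := inB_mono hk hw'
      have hT : ∀ x, |x| ∈ TT r d → bal (w * rf ((k+1 : ℕ) : ℤ) (-d i)) x → |x| ∈ TT (i+1) d := by
        intro x hx hb
        rcases (SCyc.TT_split hi2.le |x|).1 hx with h1 | h1
        · exact h1
        · rw [s2.balT hw'N h1] at hb; norm_num at hb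
      have hdec : cod N (w * rf ((k+1 : ℕ) : ℤ) (-d i)) + 1 = cod N w := by
        refine dec_of_bal hw2 hnN haN (hrel _ haT) (hdN (i+1+0) hi2) ((h.balT hw2 (hd0 (i+1+0) hi2)).2 rfl) ?_
        rw [s2.bal_iff hw'N (i := 0) (by omega)]; norm_num
      rw [if_pos hdec, ih _ hw' (h.UB_minus hw2 hw'N hag hub s1 hT) _ _ _ (s2.neg hw'N) (by
        rw [show i + 1 + (r - (i + 1) - 1) = r - 1 by omega, hn]; ring), Rw_neg,
        h.Rw_split hw2 hi2.le hdN hw'N hag s1 hm]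
      unfold Cf Wt
      rw [if_pos rfl, if_neg (by norm_num), show r - (i+1) - 1 = r - 1 - 1 - i by omega]
      ring
  · intro a b ha hb hab
    exact h.inj a b (by omega) (by omega) hab
  · intro i hi
    exact h.ne i (by omega)
  · intro i hi h2
    rw [← habs] at h2
    have := h.inj i (r-1) (by omega) (by omega) h2
    omega
  · intro i hi
    rw [mem_Sf]
    refine ⟨fun h2 => ?_, hdS i (by omega)⟩
    have := h.inj i (r-1) (by omega) (by omega) (by rw [h2, habs])
    omega
  · intro i hi
    rw [mem_Sf]
    refine ⟨fun h2 => ?_, ss_neg.2 (hdS i (by omega))⟩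
    have := h.inj i (r-1) (by omega) (by omega) (by rw [← abs_neg, h2, habs])
    omega
  · rw [mem_Sf]
    exact ⟨by push_cast; omega, ss_neg.2 hnS⟩
  · intro a ha hne hne2 hne3
    rw [if_neg]
    intro hdec
    rw [mem_Sf] at ha
    have haN : a ∈ signedSet N := hmN ha.2
    have hsc : SameCycle w ((k+1 : ℕ) : ℤ) a := by
      rcases rel_of_dec hw2 hnN haN hdec with h1 | ⟨h1, h2⟩
      · exact h1
      · exact hub _ _ (ss_iff.1 hnN).1 (ss_iff.1 haN).1 h1 h2
    obtain ⟨t, ht, h2⟩ := mem_TT.1 (h.orbT hw2 hnT hsc)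
    by_cases h3 : t = r - 1
    · rw [h3, hdn, abs_neg] at h2
      rcases abs_eq_abs.1 h2 with h4 | h4
      · exact ha.1 h4.symm
      · exact hne3 (by rw [h4, neg_neg])
    · rcases abs_eq_abs.1 h2 with h4 | h4
      · exact hne t (by omega) h4.symm
      · exact hne2 t (by omega) (by rw [h4, neg_neg])

end

section
variable {N m k : ℕ}

theorem PP_base (hm : 1 ≤ m) (hk : k + 1 ≤ N) (ih : ∀ w, inB k w → UB w → FF N m k w = val m N w)
    (w : Equiv.Perm ℤ) (hw : inB (k+1) w) (hub : UB w) (r : ℕ) (e : ℤ) (d : ℕ → ℤ)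
    (h : SCyc w r e d) (hn : d (r-1) = e * ((k+1 : ℕ) : ℤ)) :
    PP N m k 0 w = Cf m e r 0 * Rw m N w r d := by
  have hr := h.pos
  have hwn := h.w_n hw hn
  rw [PP_zero]
  by_cases hfix : w ((k+1 : ℕ) : ℤ) = ((k+1 : ℕ) : ℤ)
  · have h0 : d 0 = ((k+1 : ℕ) : ℤ) := by rw [← hwn, hfix]
    have hr1 : r = 1 := by
      have := h.inj 0 (r-1) (by omega) (by omega) (by rw [h0, hn, sgn_abs h.sgn])
      omega
    subst hr1
    have he : e = 1 := by
      rcases h.sgn with he | he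
      · exact he
      · rw [he, Nat.sub_self, h0] at hn; push_cast at hn; omega
    subst he
    rw [ih w (inB_pred hw hfix) hub, h.val_eq (inB_mono hk hw) (i := 0) (by omega) (by
      rw [h0, ss_iff]; push_cast; omega) hm]
    unfold Wt Cf
    rw [if_neg (by norm_num), if_neg (by norm_num), Av_one]; simp
  · rw [FF_not]
    · suffices Cf m e r 0 = 0 by rw [this, zero_mul]
      unfold Cf
      split_ifs with he
      · simp
      · have he1 : e = 1 := by
          rcases h.sgn with he1 | he1
          · exact he1
          · exact absurd he1 he
        have : r - 1 ≠ 0 := by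
          intro h1
          rw [h1, he1, one_mul] at hn
          exact hfix (by rw [hwn, hn])
        rw [pow_zero, PowerSeries.coeff_one, if_neg this]
    · intro h1
      exact hfix (h1.2 _ (by rw [ss_iff]; push_cast; omega))

theorem PP_main (hm : 1 ≤ m) (hk : k + 1 ≤ N) (ih : ∀ w, inB k w → UB w → FF N m k w = val m N w) (j : ℕ) :
    ∀ w, inB (k+1) w → UB w → ∀ r e d, SCyc w r e d → d (r-1) = e * ((k+1 : ℕ) : ℤ) →
      PP N m k j w = Cf m e r j * Rw m N w r d := by
  induction j with
  | zero => exact fun w hw hub r e d h hn => PP_base hm hk ih w hw hub r e d h hn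
  | succ j ihj =>
    intro w hw hub r e d h hn
    rcases h.sgn with rfl | rfl
    · exact PP_e1 hm hk j ihj w hw hub r d h hn
    · exact PP_m1 hm hk j ihj w hw hub r d h hn

theorem exists_SCyc_n {w : Equiv.Perm ℤ} (hw : inB N w) {n : ℤ} (hn : n ≠ 0) :
    ∃ r e d, SCyc w r e d ∧ d (r-1) = e * n := by
  have hx : w n ≠ 0 := by
    intro h
    have h0 : w 0 = 0 := by have := hw.1 0; rw [neg_zero] at this; omega
    exact hn (w.injective (by rw [h, h0]))
  obtain ⟨r, e, h⟩ := exists_SCyc hw hx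
  refine ⟨r, e, _, h, ?_⟩
  have h1 := h.last (r-1) (by have := h.pos; omega)
  simp only [pow_zero, Equiv.Perm.one_apply] at h1
  rw [← sgn_map h.sgn hw.1] at h1
  exact w.injective h1

theorem FF_val (hm : 1 ≤ m) (k : ℕ) (hk : k ≤ N) : ∀ w, inB k w → UB w → FF N m k w = val m N w := by
  induction k with
  | zero =>
    intro w hw _
    rw [inB_zero hw, FF_base, val_one]
  | succ k ih =>
    intro w hw hub
    have hnS := n_mem k
    obtain ⟨r, e, d, h, hn⟩ := exists_SCyc_n hw (ss_iff.1 hnS).1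
    have hr := h.pos
    rw [FF_succ hk, h.val_eq (inB_mono hk hw) (i := r-1) (by omega) (by
      rw [hn, ss_iff]; rcases h.sgn with he | he <;> rw [he] <;> push_cast <;> omega) hm]
    have : Wt m e r = ∑ j ∈ Finset.range (m+1), (m.choose j : ℝ) * Cf m e r j := by
      obtain ⟨q, rfl⟩ : ∃ q, r = q + 1 := ⟨r-1, by omega⟩
      unfold Wt Cf
      simp only [Nat.add_sub_cancel]
      by_cases he : e = -1
      · simp only [if_pos he, Bv_rec m q hm]
      · simp only [if_neg he, Av_rec m q]
    rw [this, Finset.sum_mul]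
    refine Finset.sum_congr rfl fun j _ => ?_
    rw [PP_main hm hk (ih (by omega)) j w hw hub r e d h hn, mul_assoc]
end


def Lg (p : ℕ) : List ℤ := ((List.range p).map fun i : ℕ => ((i : ℤ) + 1)) ++ ((List.range p).map fun i : ℕ => -((i : ℤ) + 1))

theorem Lg_len (p : ℕ) : (Lg p).length = p + p := by simp [Lg]

theorem Lg_nodup (p : ℕ) : (Lg p).Nodup := by
  unfold Lg
  rw [List.nodup_append]
  refine ⟨List.Nodup.map (by intro a b h; simpa using h) List.nodup_range,
    List.Nodup.map (by intro a b h; simpa using h) List.nodup_range, ?_⟩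
  intro a ha b hb
  simp only [List.mem_map, List.mem_range] at ha hb
  obtain ⟨i, _, rfl⟩ := ha
  obtain ⟨j, _, rfl⟩ := hb
  omega

theorem Lg_mem (p : ℕ) (x : ℤ) : x ∈ Lg p ↔ x ∈ signedSet p := by
  unfold Lg
  rw [ss_iff]
  simp only [List.mem_append, List.mem_map, List.mem_range]
  constructor
  · rintro (⟨i, _, rfl⟩ | ⟨i, _, rfl⟩) <;> omega
  · intro h
    by_cases hx : 0 < x
    · left; exact ⟨(x-1).toNat, by omega, by omega⟩
    · right; exact ⟨(-x-1).toNat, by omega, by omega⟩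

theorem Lg_get1 (p i : ℕ) (h : i < (Lg p).length) (hi : i < p) : (Lg p)[i] = (i:ℤ) + 1 := by
  simp only [Lg]; rw [List.getElem_append_left (by simpa using hi)]; simp

theorem Lg_get2 (p i : ℕ) (h : i < (Lg p).length) (hi : p ≤ i) : (Lg p)[i] = -(((i-p : ℕ):ℤ) + 1) := by
  simp only [Lg]; rw [List.getElem_append_right (by simpa using hi)]; simp

theorem fp_step (p i : ℕ) (hi : i < p + p) : (Lg p).formPerm ((Lg p)[i]'(by rw [Lg_len]; exact hi)) =
   (Lg p)[(i+1) % (p+p)]'(by rw [Lg_len]; exact Nat.mod_lt _ (by omega)) := by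
  rw [List.formPerm_apply_getElem _ (Lg_nodup p)]
  simp only [Lg_len]

theorem fp_off (p : ℕ) (x : ℤ) (h : x ∉ signedSet p) : (Lg p).formPerm x = x :=
  List.formPerm_apply_of_notMem (by rwa [Lg_mem])

theorem fp1 (p : ℕ) (x : ℤ) (h1 : 1 ≤ x) (h2 : x < p) : (Lg p).formPerm x = x + 1 := by
  have := fp_step p (x-1).toNat (by omega)
  have e : ((x-1).toNat + 1) % (p+p) = (x-1).toNat + 1 := Nat.mod_eq_of_lt (by omega)
  simp only [e] at this
  rw [Lg_get1 _ _ _ (by omega), Lg_get1 _ _ _ (by omega)] at this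
  rw [show (((x-1).toNat : ℕ) : ℤ) = x - 1 by omega] at this
  push_cast at this
  rw [show x - 1 + 1 = x by ring] at this
  omega

theorem fp2 (p : ℕ) (x : ℤ) (h1 : -(p:ℤ) < x) (h2 : x ≤ -1) : (Lg p).formPerm x = x - 1 := by
  have := fp_step p (p + (-x-1).toNat) (by omega)
  have e : (p + (-x-1).toNat + 1) % (p+p) = p + (-x-1).toNat + 1 := Nat.mod_eq_of_lt (by omega)
  simp only [e] at this
  rw [Lg_get2 _ _ _ (by omega), Lg_get2 _ _ _ (by omega)] at this
  rw [show -(((p + (-x-1).toNat - p : ℕ):ℤ) + 1) = x by omega] at this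
  omega

theorem fp3 (p : ℕ) (hp : 1 ≤ p) : (Lg p).formPerm p = -1 := by
  have := fp_step p (p-1) (by omega)
  have e : (p-1+1) % (p+p) = p := by rw [Nat.sub_add_cancel hp]; exact Nat.mod_eq_of_lt (by omega)
  simp only [e] at this
  rw [Lg_get1 _ _ _ (by omega), Lg_get2 _ _ _ (by omega)] at this
  rw [show (((p-1:ℕ):ℤ) + 1) = p by omega] at this
  rw [this]; simp

theorem fp4 (p : ℕ) (hp : 1 ≤ p) : (Lg p).formPerm (-p) = 1 := by
  have := fp_step p (p+(p-1)) (by omega)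
  have e : (p+(p-1)+1) % (p+p) = 0 := by rw [show p + (p-1)+1 = p+p by omega, Nat.mod_self]
  simp only [e] at this
  rw [Lg_get2 _ _ _ (by omega), Lg_get1 _ _ _ (by omega)] at this
  rw [show -(((p+(p-1)-p:ℕ):ℤ) + 1) = -(p:ℤ) by omega] at this
  rw [this]; simp

theorem gam_eq (p : ℕ) : gammaPQ p 1 = (Lg p).formPerm * Equiv.swap ((p:ℤ)+1) (-((p:ℤ)+1)) := by
  have e : ∀ l : List ℕ, (do let a ← l; pure ((a : ℕ) : ℤ)) = l.map (fun i : ℕ => (i:ℤ)) := by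
    intro l; induction l with
    | nil => rfl
    | cons a l ih => simpa using ih
  unfold gammaPQ Lg
  rw [e, e, List.map_map, List.map_map]
  rfl

theorem gam_n (p : ℕ) : gammaPQ p 1 ((p:ℤ)+1) = -((p:ℤ)+1) := by
  rw [gam_eq, Equiv.Perm.mul_apply, Equiv.swap_apply_left, fp_off]
  rw [ss_iff]; omega

theorem gam_nn (p : ℕ) : gammaPQ p 1 (-((p:ℤ)+1)) = ((p:ℤ)+1) := by
  rw [gam_eq, Equiv.Perm.mul_apply, Equiv.swap_apply_right, fp_off]
  rw [ss_iff]; omega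

theorem gam_o (p : ℕ) (x : ℤ) (h1 : x ≠ (p:ℤ)+1) (h2 : x ≠ -((p:ℤ)+1)) : gammaPQ p 1 x = (Lg p).formPerm x := by
  rw [gam_eq, Equiv.Perm.mul_apply, Equiv.swap_apply_of_ne_of_ne h1 h2]

theorem gam_inB (p : ℕ) (hp : 1 ≤ p) : inB (p+1) (gammaPQ p 1) := by
  constructor
  · intro x
    by_cases h1 : x = (p:ℤ)+1
    · rw [h1, gam_n, gam_nn]; ring
    by_cases h2 : x = -((p:ℤ)+1)
    · rw [h2, neg_neg, gam_n, gam_nn]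
    rw [gam_o _ _ h1 h2, gam_o _ _ (by omega) (by omega)]
    by_cases h3 : x ∈ signedSet p
    · rw [ss_iff] at h3
      by_cases h4 : x = p
      · rw [h4, fp3 p hp, fp4 p hp]; rfl
      by_cases h5 : x = -p
      · rw [h5, neg_neg, fp3 p hp, fp4 p hp]
      by_cases h6 : 0 < x
      · rw [fp1 p x (by omega) (by omega), fp2 p _ (by omega) (by omega)]; ring
      · rw [fp2 p x (by omega) (by omega), fp1 p _ (by omega) (by omega)]; ring
    · rw [fp_off p x h3, fp_off p _ (fun h => h3 (ss_neg.1 h))]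
  · intro x hx
    rw [ss_iff] at hx
    push_cast at hx
    rw [gam_o _ _ (by omega) (by omega), fp_off]
    rw [ss_iff]; omega

def rot (p t j : ℕ) : ℤ := if t + 1 + j ≤ p then ((t + 1 + j : ℕ) : ℤ) else (p : ℤ) - ((t + 1 + j : ℕ) : ℤ)

theorem rot_cyc (p t : ℕ) (ht : t ≤ p) (hp : 1 ≤ p) : SCyc (gammaPQ p 1) p (-1) (rot p t) := by
  refine ⟨hp, Or.inr rfl, fun j hj => ?_, fun i j hi hj hij => ?_, fun j hj => ?_, fun j hj => ?_⟩
  · unfold rot; split_ifs <;> push_cast <;> omega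
  · rcases abs_eq_abs.1 hij with h | h <;> unfold rot at h <;> split_ifs at h <;> push_cast at h <;> omega
  · unfold rot
    split_ifs with h1 h2 h2
    · rw [gam_o _ _ (by omega) (by omega), fp1 _ _ (by push_cast; omega) (by omega)]; push_cast; ring
    · rw [show t + 1 + j = p by omega, gam_o _ _ (by omega) (by omega), fp3 p hp]; push_cast; omega
    · omega
    · rw [gam_o _ _ (by omega) (by omega), fp2 _ _ (by push_cast; omega) (by push_cast; omega)]; push_cast; ring
  · have e : j = p - 1 := by omega
    unfold rot
    split_ifs with h1 h2 h2
    · have : t = 0 := by omega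
      rw [show t + 1 + j = p by omega, gam_o _ _ (by omega) (by omega), fp3 p hp, this]; rfl
    · omega
    · rw [gam_o _ _ (by omega) (by omega), fp2 _ _ (by push_cast; omega) (by push_cast; omega)]; push_cast; omega
    · rw [show (p:ℤ) - ((t+1+j:ℕ):ℤ) = -p by omega, gam_o _ _ (by omega) (by omega), fp4 p hp]; push_cast; omega

theorem rot_TT (p t : ℕ) (ht : t ≤ p) (x : ℤ) : x ∈ TT p (rot p t) ↔ 1 ≤ x ∧ x ≤ p := by
  rw [mem_TT]
  constructor
  · rintro ⟨j, hj, rfl⟩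
    unfold rot; split_ifs with h
    · rw [abs_of_nonneg (by omega)]; push_cast; omega
    · rw [abs_of_neg (by push_cast; omega)]; push_cast; omega
  · rintro ⟨h1, h2⟩
    by_cases h3 : t < x
    · refine ⟨(x - t - 1).toNat, by omega, ?_⟩
      unfold rot; rw [if_pos (by omega), abs_of_nonneg (by omega)]; omega
    · refine ⟨(p + x - t - 1).toNat, by omega, ?_⟩
      unfold rot; rw [if_neg (by omega), abs_of_neg (by omega)]; omega


theorem gam_n' (p : ℕ) : gammaPQ p 1 ((p+1:ℕ):ℤ) = -((p+1:ℕ):ℤ) := by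
  push_cast; exact gam_n p

theorem gam_bal (p : ℕ) (hp : 1 ≤ p) {x : ℤ} (hx : x ∈ signedSet (p+1)) : bal (gammaPQ p 1) x := by
  have hw := gam_inB p hp
  by_cases h : |x| ≤ p
  · exact ((rot_cyc p 0 (by omega) hp).balT hw ((rot_TT p 0 (by omega) _).2 ⟨by
      have := abs_pos.2 (ss_iff.1 hx).1; omega, h⟩)).2 rfl
  · have hb : bal (gammaPQ p 1) ((p+1:ℕ):ℤ) := ⟨1, by rw [zpow_one]; exact gam_n' p⟩
    rw [ss_iff] at hx
    rw [abs_le] at h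
    have : x = ((p+1:ℕ):ℤ) ∨ x = -((p+1:ℕ):ℤ) := by push_cast at *; omega
    rcases this with rfl | rfl
    · exact hb
    · rw [bal_neg]; exact hb

theorem gam_Fx (p : ℕ) (hp : 1 ≤ p) : Fx (p+1) (gammaPQ p 1) = ⊥ := by
  rw [eq_bot_iff]
  intro v hv
  rw [Submodule.mem_bot]
  funext x
  by_cases hx : x ∈ signedSet (p+1)
  · exact Fx_bal hv (gam_bal p hp hx)
  · exact hv.1.2 x hx

theorem join_cyc {p : ℕ} {w : Equiv.Perm ℤ} {N : ℕ} (hw : inB N w) {d : ℕ → ℤ} {n a : ℤ} (h : SCyc w p (-1) d)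
    (ha : d (p-1) = -a) (hn0 : n ≠ 0) (hn : w n = -n) (hd : ∀ j, j < p → |d j| ≠ |n|) :
    SCyc (w * rf n a) (p+1) 1 (fun j => if j < p then d j else n) := by
  have hp := h.pos
  have ha0 : a ≠ 0 := by
    have := h.ne (p-1) (by omega)
    omega
  refine ⟨by omega, Or.inl rfl, fun j hj => ?_, fun i j hi hj hij => ?_, fun j hj => ?_, fun j hj => ?_⟩
  · split_ifs with h1
    · exact h.ne j h1
    · exact hn0
  · split_ifs at hij with h1 h2 h2
    · exact h.inj i j h1 h2 hij
    · exact absurd hij (hd i h1)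
    · exact absurd hij.symm (hd j h2)
    · omega
  · rw [if_pos (by omega), Equiv.Perm.mul_apply]
    by_cases h1 : j + 1 < p
    · rw [if_pos h1, rf_off hn0 ha0 (hd j (by omega)), h.step j h1]
      rw [← abs_neg a, ← ha]
      intro h2
      have := h.inj _ _ (by omega) (by omega) h2
      omega
    · rw [if_neg h1, show j = p - 1 by omega, ha, rf_neg hn0 ha0, rf_right hn0 ha0, hw.1, hn, neg_neg]
  · rw [if_neg (by omega), if_pos hp, Equiv.Perm.mul_apply, rf_left hn0 ha0]
    have := h.last (p-1) (by omega)
    rw [ha, hw.1] at this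
    omega

theorem bal_out {N : ℕ} {w : Equiv.Perm ℤ} (hw : inB N w) {x : ℤ} (hx : x ≠ 0) (hb : bal w x) : x ∈ signedSet N := by
  by_contra h
  obtain ⟨i, hi⟩ := hb
  have h1 : w x = x := hw.2 x h
  have : (w ^ i) x = x := Equiv.Perm.zpow_apply_eq_self_of_apply_eq_self h1 i
  omega

section
variable {p m : ℕ}

theorem dec_all (hp : 1 ≤ p) {a x : ℤ} (ha : a ∈ signedSet (p+1)) (hx : x ∈ signedSet (p+1))
    (hb : ¬ bal (gammaPQ p 1 * rf ((p+1:ℕ):ℤ) a) x) :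
    cod (p+1) (gammaPQ p 1 * rf ((p+1:ℕ):ℤ) a) + 1 = cod (p+1) (gammaPQ p 1) :=
  dec_of_bal (gam_inB p hp) (n_mem p) ha (Or.inr ⟨gam_bal p hp (n_mem p), gam_bal p hp ha⟩) hx (gam_bal p hp hx) hb

theorem top_join (hm : 1 ≤ m) (hp : 1 ≤ p) (k : ℕ) {d : ℕ → ℤ} {a : ℤ} (h : SCyc (gammaPQ p 1) p (-1) d)
    (hT : ∀ x, x ∈ TT p d ↔ 1 ≤ x ∧ x ≤ p) (ha : d (p-1) = -a) :
    (if cod (p+1) (gammaPQ p 1 * rf ((p+1:ℕ):ℤ) a) + 1 = cod (p+1) (gammaPQ p 1) then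
      PP (p+1) m p k (gammaPQ p 1 * rf ((p+1:ℕ):ℤ) a) else 0) = PowerSeries.coeff p (GG m ^ k) := by
  have hγ := gam_inB p hp
  have hnS := n_mem p
  have haS : a ∈ signedSet (p+1) := by
    have h1 := (hT |d (p-1)|).1 (mem_TT.2 ⟨p-1, by omega, rfl⟩)
    rw [ha, abs_neg, abs_le] at h1
    have h2 := h.ne (p-1) (by omega)
    rw [ss_iff]; push_cast; omega
  have s := join_cyc hγ h ha (ss_iff.1 hnS).1 (gam_n' p) (fun j hj h2 => by
    have h1 := (hT |d j|).1 (mem_TT.2 ⟨j, hj, rfl⟩)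
    rw [h2, abs_of_nonneg (by omega)] at h1
    push_cast at h1; omega)
  have hw' : inB (p+1) (gammaPQ p 1 * rf ((p+1:ℕ):ℤ) a) := inB_mul hγ (rf_inB hnS haS)
  have hTT : ∀ x, 1 ≤ x → x ≤ ((p+1:ℕ):ℤ) → x ∈ TT (p+1) (fun j => if j < p then d j else ((p+1:ℕ):ℤ)) := by
    intro x h1 h2
    rw [mem_TT]
    by_cases h3 : x ≤ p
    · obtain ⟨j, hj, hj2⟩ := mem_TT.1 ((hT x).2 ⟨h1, h3⟩)
      exact ⟨j, by omega, by rw [if_pos hj, hj2]⟩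
    · refine ⟨p, by omega, ?_⟩
      rw [if_neg (by omega), abs_of_nonneg (by omega)]; push_cast at *; omega
  have hnb : ∀ x, x ∈ signedSet (p+1) → ¬ bal (gammaPQ p 1 * rf ((p+1:ℕ):ℤ) a) x := by
    intro x hx
    rw [s.balT hw' (hTT |x| (by have := abs_pos.2 (ss_iff.1 hx).1; omega) hx.2)]
    norm_num
  have hub : UB (gammaPQ p 1 * rf ((p+1:ℕ):ℤ) a) := by
    intro x y hx hy bx _
    exact absurd bx (hnb x (bal_out hw' hx bx))
  rw [if_pos (dec_all hp haS hnS (hnb _ hnS)),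
    PP_main hm le_rfl (FF_val hm p (by omega)) k _ hw' hub _ _ _ s (by
      rw [Nat.add_sub_cancel, if_neg (by omega), one_mul])]
  have : Rw m (p+1) (gammaPQ p 1 * rf ((p+1:ℕ):ℤ) a) (p+1) (fun j => if j < p then d j else ((p+1:ℕ):ℤ)) = 1 := by
    unfold Rw
    rw [Finset.sdiff_eq_empty_iff_subset.2, Finset.prod_empty]
    intro x hx
    rw [Finset.mem_Icc] at hx
    exact hTT x hx.1 hx.2
  rw [this, mul_one]
  unfold Cf
  rw [if_neg (by norm_num), Nat.add_sub_cancel]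

theorem top_neg (hm : 1 ≤ m) (hp : 1 ≤ p) (k : ℕ) :
    (if cod (p+1) (gammaPQ p 1 * rf ((p+1:ℕ):ℤ) (-((p+1:ℕ):ℤ))) + 1 = cod (p+1) (gammaPQ p 1) then
      PP (p+1) m p k (gammaPQ p 1 * rf ((p+1:ℕ):ℤ) (-((p+1:ℕ):ℤ))) else 0) =
      PowerSeries.coeff 0 (GG m ^ k) * Bv m p := by
  have hγ := gam_inB p hp
  have hnS := n_mem p
  have hn0 := (ss_iff.1 hnS).1
  have hw' : inB (p+1) (gammaPQ p 1 * rf ((p+1:ℕ):ℤ) (-((p+1:ℕ):ℤ))) := inB_mul hγ (rf_inB hnS (ss_neg.2 hnS))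
  have hfix : (gammaPQ p 1 * rf ((p+1:ℕ):ℤ) (-((p+1:ℕ):ℤ))) ((p+1:ℕ):ℤ) = ((p+1:ℕ):ℤ) := by
    rw [Equiv.Perm.mul_apply, rf_left hn0 (by omega), hγ.1, gam_n', neg_neg]
  have s := scyc_one hn0 hfix
  have hd : ∀ j, j < p → |rot p 0 j| ≤ p := fun j hj => ((rot_TT p 0 (by omega) _).1 (mem_TT.2 ⟨j, hj, rfl⟩)).2
  have hrf : ∀ j, j < p → rf ((p+1:ℕ):ℤ) (-((p+1:ℕ):ℤ)) (rot p 0 j) = rot p 0 j := by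
    intro j hj
    have h1 := hd j hj
    apply rf_off hn0 (by omega)
    · rw [abs_of_nonneg (a := ((p+1:ℕ):ℤ)) (by omega)]; push_cast; omega
    · rw [abs_neg, abs_of_nonneg (a := ((p+1:ℕ):ℤ)) (by omega)]; push_cast; omega
  have h := rot_cyc p 0 (by omega) hp
  have h' : SCyc (gammaPQ p 1 * rf ((p+1:ℕ):ℤ) (-((p+1:ℕ):ℤ))) p (-1) (rot p 0) :=
    ⟨h.pos, h.sgn, h.ne, h.inj, fun j hj => by rw [Equiv.Perm.mul_apply, hrf j (by omega), h.step j hj],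
      fun j hj => by rw [Equiv.Perm.mul_apply, hrf j (by omega), h.last j hj]⟩
  have hnb : ¬ bal (gammaPQ p 1 * rf ((p+1:ℕ):ℤ) (-((p+1:ℕ):ℤ))) ((p+1:ℕ):ℤ) := by
    rw [s.bal_iff (i := 0) hw' (by omega)]; norm_num
  have hbT : ∀ x, x ≠ 0 → bal (gammaPQ p 1 * rf ((p+1:ℕ):ℤ) (-((p+1:ℕ):ℤ))) x → |x| ∈ TT p (rot p 0) := by
    intro x hx hb
    rw [rot_TT p 0 (by omega)]
    have h1 := abs_pos.2 hx
    refine ⟨by omega, ?_⟩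
    by_contra h2
    have h3 := bal_out hw' hx hb
    rw [ss_iff] at h3
    rw [abs_le] at h2
    have : x = ((p+1:ℕ):ℤ) ∨ x = -((p+1:ℕ):ℤ) := by push_cast at *; omega
    rcases this with h4 | h4
    · rw [h4] at hb; exact hnb hb
    · rw [h4, bal_neg] at hb; exact hnb hb
  have hub : UB (gammaPQ p 1 * rf ((p+1:ℕ):ℤ) (-((p+1:ℕ):ℤ))) := fun x y hx hy bx bY =>
    h'.scT hw' (hbT x hx bx) (hbT y hy bY)
  rw [if_pos (dec_all hp (ss_neg.2 hnS) hnS hnb),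
    PP_main hm le_rfl (FF_val hm p (by omega)) k _ hw' hub _ _ _ s (by rw [one_mul])]
  have e1 : Rw m (p+1) (gammaPQ p 1 * rf ((p+1:ℕ):ℤ) (-((p+1:ℕ):ℤ))) 1 (fun _ => ((p+1:ℕ):ℤ)) = Bv m p := by
    have := h'.prod_TT hw' hm
    unfold Wt at this
    rw [if_pos rfl] at this
    rw [← this]
    unfold Rw
    congr 1
    ext x
    rw [Finset.mem_sdiff, Finset.mem_Icc, rot_TT p 0 (by omega), mem_TT]
    constructor
    · rintro ⟨⟨h1, h2⟩, h3⟩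
      refine ⟨h1, ?_⟩
      by_contra h4
      refine h3 ⟨0, by omega, ?_⟩
      rw [abs_of_nonneg (by omega)]; push_cast at *; omega
    · rintro ⟨h1, h2⟩
      refine ⟨⟨h1, by push_cast; omega⟩, ?_⟩
      rintro ⟨_, _, h3⟩
      rw [abs_of_nonneg (by omega)] at h3; push_cast at *; omega
  rw [e1]
  unfold Cf
  rw [if_neg (by norm_num)]

theorem top_PP (hm : 1 ≤ m) (hp : 1 ≤ p) (k : ℕ) : PP (p+1) m p (k+1) (gammaPQ p 1) =
    PowerSeries.coeff 0 (GG m ^ k) * Bv m p + 2 * p * PowerSeries.coeff p (GG m ^ k) := by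
  have hnS := n_mem p
  have hrt : ∀ i, i < p → rot p (i+1) (p-1) = -((i:ℤ)+1) := by
    intro i hi; unfold rot; rw [if_neg (by omega)]; omega
  rw [PP_succ, sum_e2 (q := p) (d := fun i => (i:ℤ)+1) (n := ((p+1:ℕ):ℤ)), top_neg hm hp]
  · congr 1
    rw [Finset.sum_congr rfl (g := fun _ => PowerSeries.coeff p (GG m ^ k)),
      Finset.sum_congr (s₁ := Finset.range p) rfl (f := fun i => if cod (p+1) (gammaPQ p 1 * rf ((p+1:ℕ):ℤ) (-((i:ℤ)+1))) + 1 = cod (p+1) (gammaPQ p 1) then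
      PP (p+1) m p k (gammaPQ p 1 * rf ((p+1:ℕ):ℤ) (-((i:ℤ)+1))) else 0) (g := fun _ => PowerSeries.coeff p (GG m ^ k))]
    · rw [Finset.sum_const, Finset.card_range, nsmul_eq_mul]; ring
    · intro i hi
      rw [Finset.mem_range] at hi
      refine top_join hm hp k ((rot_cyc p (i+1) (by omega) hp).neg (gam_inB p hp)) (fun x => ?_) ?_
      · rw [TT_neg, rot_TT p (i+1) (by omega)]
      · rw [hrt i hi]
    · intro i hi
      rw [Finset.mem_range] at hi
      exact top_join hm hp k (rot_cyc p (i+1) (by omega) hp) (rot_TT p (i+1) (by omega)) (hrt i hi)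
  · intro i j hi hj hij
    rw [abs_of_nonneg (by omega), abs_of_nonneg (by omega)] at hij; omega
  · intro i hi; omega
  · intro i hi
    rw [abs_of_nonneg (by omega), abs_of_nonneg (by omega)]; push_cast; omega
  · intro i hi
    rw [mem_Sf, ss_iff]; push_cast; omega
  · intro i hi
    rw [mem_Sf, ss_iff]; push_cast; omega
  · rw [mem_Sf, ss_neg]; exact ⟨by omega, hnS⟩
  · intro a ha h1 h2 h3
    exfalso
    rw [mem_Sf, ss_iff] at ha
    push_cast at ha h3
    by_cases h4 : 0 < a
    · exact h1 (a-1).toNat (by omega) (by omega)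
    · exact h2 (-a-1).toNat (by omega) (by omega)

theorem top_FF (hm : 1 ≤ m) (hp : 1 ≤ p) : FF (p+1) m (p+1) (gammaPQ p 1) =
    m * (m * p).choose p + 2 * (m * p).choose (p+1) := by
  have h0 : PP (p+1) m p 0 (gammaPQ p 1) = 0 := by
    rw [PP_zero, FF_not]
    intro h
    have := h.2 ((p+1:ℕ):ℤ) (by rw [ss_iff]; push_cast; omega)
    rw [gam_n'] at this
    push_cast at this; omega
  rw [FF_succ le_rfl, Finset.sum_range_succ', h0, mul_zero, add_zero, ← top_formula m p hm, Finset.mul_sum]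
  have : ∀ k ∈ Finset.range m, (m.choose (k+1) : ℝ) * PP (p+1) m p (k+1) (gammaPQ p 1) =
      (if k = 0 then (m:ℝ) * Bv m p else 0) + 2 * p * ((m.choose (k+1) : ℝ) * PowerSeries.coeff p (GG m ^ k)) := by
    intro k _
    rw [top_PP hm hp]
    have hA := Av_zero m
    unfold Av at hA
    have : PowerSeries.coeff 0 (GG m ^ k) = if k = 0 then (1:ℝ) else 0 := by
      rcases k with _ | k
      · simp
      · rw [pow_succ', conv_ps, hA]; simp
    rw [this]
    split_ifs with h
    · subst h; rw [zero_add, Nat.choose_one_right]; ring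
    · ring
  rw [Finset.sum_congr rfl this, Finset.sum_add_distrib, Finset.sum_ite_eq' , if_pos (by rw [Finset.mem_range]; omega)]
end


/-- For `n ≥ 2` and `m ≥ 2`, the number of multichains `π_1 ≤ ⋯ ≤ π_{m-1}` in
`NC^B(n-1,1)` equals `(2 + mn/((m-1)(n-1)))·C(m(n-1), n)`
(the zeta polynomial of `NC^B(n-1,1)`). -/
theorem ncb_nm1_1_zeta (n m : ℕ) (hn : 2 ≤ n) (hm : 2 ≤ m) :
    ({f : Fin (m - 1) → Set (Set ℤ) |
        (∀ i, f i ∈ NCB (n - 1) 1) ∧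
        (∀ i j : Fin (m - 1), i ≤ j → refines (f i) (f j))}.ncard : ℚ) =
      (2 + ((m : ℚ) * n) / (((m : ℚ) - 1) * ((n : ℚ) - 1))) *
        (Nat.choose (m * (n - 1)) n : ℚ) := by
  have hmp : 1 ≤ n - 1 := by omega
  have h1 := count_eq (p := n - 1) (q := 1) (j := m - 1) rfl (gam_inB (n-1) hmp) (gam_Fx (n-1) hmp)
  rw [show m - 1 + 1 = m by omega, top_FF (by omega) hmp] at h1
  have h2 : {f : Fin (m - 1) → Set (Set ℤ) | (∀ i, f i ∈ NCB (n - 1) 1) ∧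
        (∀ i j : Fin (m - 1), i ≤ j → refines (f i) (f j))}.ncard =
        m * (m * (n-1)).choose (n-1) + 2 * (m * (n-1)).choose (n-1+1) := by
    exact_mod_cast h1
  rw [h2]
  obtain ⟨p, rfl⟩ : ∃ p, n = p + 1 := ⟨n - 1, by omega⟩
  rw [Nat.add_sub_cancel] at *
  have h3 := Nat.choose_succ_right_eq (m * p) p
  have h4 : m * p - p = (m - 1) * p := by rw [Nat.sub_mul, one_mul]
  rw [h4] at h3
  have h5 : ((m * p).choose (p+1) : ℚ) * (p + 1) = (m * p).choose p * (((m:ℚ) - 1) * p) := by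
    have : ((m - 1 : ℕ) : ℚ) = (m:ℚ) - 1 := by push_cast [Nat.cast_sub (by omega : 1 ≤ m)]; ring
    rw [← this]
    exact_mod_cast h3
  have hm1 : (m:ℚ) - 1 ≠ 0 := by
    have : (2:ℚ) ≤ m := by exact_mod_cast hm
    linarith
  have hp0 : (p:ℚ) ≠ 0 := by
    have : (1:ℚ) ≤ p := by exact_mod_cast hmp
    linarith
  push_cast
  rw [add_sub_cancel_right]
  field_simp
  linear_combination (-(m:ℚ)) * h5
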